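/- arXiv:1905.10897 — 3 statements merged into one kernel-verified Lean document; each statement's English description precedes it below -/
import Mathlib

section
/- Let q ≥ 2 be an integer and let f : ℕ → ℂ be a multiplicative q-automatic sequence. Then there exist an integer Q ≥ 1 and a Dirichlet character χ modulo Q such that either f(n) = χ(n) for all positive integers n with gcd(n, Q) = 1, or there exists N such that f(p) = 0 for all primes p > N. -/
/-- The `q`-kernel of `f`: the set of sequences `n ↦ f (q^i n + r)` over integers
`i ≥ 1` and `0 ≤ r ≤ q^i - 1`. -/
def qKernel (q : ℕ) (f : ℕ → ℂ) : Set (ℕ → ℂ) :=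
  {g | ∃ i r : ℕ, 1 ≤ i ∧ r ≤ q ^ i - 1 ∧ g = fun n => f (q ^ i * n + r)}

/-- `f` is `q`-automatic if its `q`-kernel is finite. -/
def IsQAutomatic (q : ℕ) (f : ℕ → ℂ) : Prop := (qKernel q f).Finite


namespace MA

/-- `n` and `m` have the same continuations. -/
def Eqv (q : ℕ) (f : ℕ → ℂ) (n m : ℕ) : Prop :=
  ∀ i r, r < q ^ i → f (q ^ i * n + r) = f (q ^ i * m + r)

section basics
variable {q : ℕ} {f : ℕ → ℂ}

theorem Eqv.refl (n : ℕ) : Eqv q f n n := fun _ _ _ => rfl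
theorem Eqv.symm {n m : ℕ} (h : Eqv q f n m) : Eqv q f m n := fun i r hr => (h i r hr).symm
theorem Eqv.trans {n m k : ℕ} (h : Eqv q f n m) (h' : Eqv q f m k) : Eqv q f n k :=
  fun i r hr => (h i r hr).trans (h' i r hr)

theorem Eqv.val {n m : ℕ} (h : Eqv q f n m) : f n = f m := by
  simpa using h 0 0 (by simp)

theorem word_lt {q i r j s : ℕ} (hr : r < q ^ i) (hs : s < q ^ j) :
    q ^ j * r + s < q ^ (i + j) := by
  calc q ^ j * r + s < q ^ j * r + q ^ j := by omega
    _ = q ^ j * (r + 1) := by ring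
    _ ≤ q ^ j * q ^ i := Nat.mul_le_mul_left _ hr
    _ = q ^ (i + j) := by ring

theorem word_app (q i r j s n : ℕ) :
    q ^ j * (q ^ i * n + r) + s = q ^ (i + j) * n + (q ^ j * r + s) := by ring

theorem Eqv.app {n m : ℕ} (h : Eqv q f n m) {i r : ℕ} (hr : r < q ^ i) :
    Eqv q f (q ^ i * n + r) (q ^ i * m + r) := by
  intro j s hs
  rw [word_app, word_app]
  exact h _ _ (word_lt hr hs)

/-- The setoid of equal continuations. -/
def sd (q : ℕ) (f : ℕ → ℂ) : Setoid ℕ where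
  r := Eqv q f
  iseqv := ⟨Eqv.refl, Eqv.symm, Eqv.trans⟩

theorem fin_quot (hq : 2 ≤ q) (h : IsQAutomatic q f) : Finite (Quotient (sd q f)) := by
  have hfin : (qKernel q f).Finite := h
  have : Finite (qKernel q f) := hfin
  set V : Set ℂ := (fun g : ℕ → ℂ => g 0) '' qKernel q f with hV
  have hVf : V.Finite := hfin.image _
  have : Finite V := hVf
  have hf : ∀ n, f n ∈ V := by
    intro n
    have hlt : n < q ^ (n + 1) := (Nat.lt_pow_self (by omega : 1 < q)).trans
      (Nat.pow_lt_pow_right (by omega) (by omega))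
    refine ⟨fun k => f (q ^ (n + 1) * k + n), ⟨n + 1, n, by omega, by omega, rfl⟩, by simp⟩
  have hg : ∀ (g : qKernel q f) n, g.1 n ∈ V := by
    rintro ⟨g, i, r, hi, hr, rfl⟩ n
    exact hf _
  let F : ℕ → V × (qKernel q f → V) := fun n => (⟨f n, hf n⟩, fun g => ⟨g.1 n, hg g n⟩)
  have hF : ∀ n m, F n = F m → Eqv q f n m := by
    intro n m hnm i r hr
    have h1 := congrArg Prod.fst hnm
    have h2 := congrArg Prod.snd hnm
    simp only [F, Subtype.mk.injEq] at h1
    rcases Nat.eq_zero_or_pos i with rfl | hi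
    · have : r = 0 := by simpa using hr
      subst this
      simpa using h1
    · have := congrFun h2 ⟨fun k => f (q ^ i * k + r), ⟨i, r, hi, by omega, rfl⟩⟩
      simpa [F] using this
  let G : Quotient (sd q f) → V × (qKernel q f → V) := fun c => F c.out
  refine Finite.of_injective G ?_
  intro c d hcd
  have := hF _ _ hcd
  rw [← Quotient.out_eq c, ← Quotient.out_eq d]
  exact Quotient.sound this

theorem mk_eq_iff {n m : ℕ} :
    (Quotient.mk (sd q f) n = Quotient.mk (sd q f) m) ↔ Eqv q f n m :=
  ⟨fun h => Quotient.exact h, fun h => Quotient.sound h⟩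

theorem bound [Finite (Quotient (sd q f))] (B : ℕ → ℕ → Prop)
    (hB : ∀ n m i, Eqv q f n m → B n i → B m i) :
    ∃ C, ∀ n, (∃ i, B n i) → ∃ i ≤ C, B n i := by
  classical
  have := Fintype.ofFinite (Quotient (sd q f))
  let g : Quotient (sd q f) → ℕ := fun c => if h : ∃ i, B c.out i then Nat.find h else 0
  refine ⟨Finset.univ.sup g, ?_⟩
  rintro n ⟨i, hi⟩
  let c := Quotient.mk (sd q f) n
  have hc : Eqv q f n c.out := (mk_eq_iff.1 (Quotient.out_eq c)).symm
  have hex : ∃ i, B c.out i := ⟨i, hB _ _ _ hc hi⟩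
  refine ⟨g c, Finset.le_sup (Finset.mem_univ c), ?_⟩
  have : g c = Nat.find hex := by simp only [g]; rw [dif_pos hex]
  rw [this]
  exact hB _ _ _ hc.symm (Nat.find_spec hex)

/-- Two distinct words of equal length with the same action. -/
theorem same_action (hq : 2 ≤ q) [Finite (Quotient (sd q f))] :
    ∃ l r d, 0 < d ∧ r + d < q ^ l ∧ ∀ n, Eqv q f (q ^ l * n + r) (q ^ l * n + (r + d)) := by
  classical
  let Ω := Quotient (sd q f)
  have := Fintype.ofFinite Ω
  let l := Fintype.card (Ω → Ω)
  have hl : l < q ^ l := Nat.lt_pow_self (by omega)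
  let A : Fin (q ^ l) → (Ω → Ω) := fun r c => Quotient.mk _ (q ^ l * c.out + r)
  obtain ⟨r, s, hrs, hA⟩ := Fintype.exists_ne_map_eq_of_card_lt A (by rw [Fintype.card_fin]; exact hl)
  have key : ∀ n, Eqv q f (q ^ l * n + r) (q ^ l * n + s) := by
    intro n
    let c : Ω := Quotient.mk (sd q f) n
    have hc : Eqv q f n c.out := (mk_eq_iff.1 (Quotient.out_eq c)).symm
    have h1 := mk_eq_iff.1 (congrFun hA c)
    exact ((hc.app r.2).trans h1).trans (hc.app s.2).symm
  rcases lt_or_gt_of_ne (Fin.val_ne_of_ne hrs) with h | h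
  · refine ⟨l, r, s - r, by omega, by omega, fun n => ?_⟩
    have : (r : ℕ) + (s - r) = s := by omega
    rw [this]; exact key n
  · refine ⟨l, s, r - s, by omega, by omega, fun n => ?_⟩
    have : (s : ℕ) + (r - s) = r := by omega
    rw [this]; exact (key n).symm

/-- A word after which distinctness persists. -/
theorem persist [Finite (Quotient (sd q f))] (hq : 2 ≤ q) :
    ∃ t w, 0 < t ∧ w < q ^ t ∧ Nat.Coprime w q ∧ ∀ n m i u, u < q ^ i →
      Eqv q f (q ^ i * (q ^ t * n + w) + u) (q ^ i * (q ^ t * m + w) + u) →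
      Eqv q f (q ^ t * n + w) (q ^ t * m + w) := by
  classical
  let Ω := Quotient (sd q f)
  let im : ℕ → ℕ → Set Ω := fun t w => Set.range fun n => Quotient.mk (sd q f) (q ^ t * n + w)
  have hex : ∃ k, ∃ t w, w < q ^ t ∧ (im t w).ncard = k := ⟨_, 0, 0, by simp, rfl⟩
  obtain ⟨t, w, hw, hk⟩ := Nat.find_spec hex
  have hmin : ∀ t' w', w' < q ^ t' → (im t w).ncard ≤ (im t' w').ncard := by
    intro t' w' h'
    rw [hk]
    exact Nat.find_min' hex ⟨t', w', h', rfl⟩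
  have key : ∀ n m i u, u < q ^ i →
      Eqv q f (q ^ i * (q ^ t * n + w) + u) (q ^ i * (q ^ t * m + w) + u) →
      Eqv q f (q ^ t * n + w) (q ^ t * m + w) := by
    intro n m i u hu h
    let φ : Ω → Ω := fun c => Quotient.mk _ (q ^ i * c.out + u)
    have hφ : ∀ n, φ (Quotient.mk _ n) = Quotient.mk _ (q ^ i * n + u) := by
      intro n
      exact Quotient.sound ((mk_eq_iff.1 (Quotient.out_eq (Quotient.mk (sd q f) n))).app hu)
    have himg : φ '' (im t w) = im (t + i) (q ^ i * w + u) := by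
      ext c
      simp only [im, Set.mem_image, Set.mem_range, exists_exists_eq_and, hφ, word_app]
    have hinj : Set.InjOn φ (im t w) := by
      apply Set.injOn_of_ncard_image_eq _ (Set.toFinite _)
      apply le_antisymm (Set.ncard_image_le (Set.toFinite _))
      rw [himg]; exact hmin _ _ (word_lt hw hu)
    refine mk_eq_iff.1 (hinj ⟨n, rfl⟩ ⟨m, rfl⟩ ?_)
    rw [hφ, hφ]
    exact mk_eq_iff.2 h
  have h1 : (1:ℕ) < q ^ 1 := by simp; omega
  refine ⟨t + 1, q ^ 1 * w + 1, by omega, word_lt hw h1, ?_, ?_⟩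
  · simp
  · intro n m i u hu h
    rw [← word_app, ← word_app] at h ⊢
    refine (key n m (1 + i) (q ^ i * 1 + u) (word_lt h1 hu) ?_).app h1
    rwa [word_app q 1 1, word_app q 1 1] at h
end basics

section partB
variable {q : ℕ} {f : ℕ → ℂ}

theorem tune (hq : 2 ≤ q) {l r d : ℕ} (hrd : r + d < q ^ l)
    (hact : ∀ n, Eqv q f (q ^ l * n + r) (q ^ l * n + (r + d)))
    {M : ℕ} (hM : 0 < M) (hMq : Nat.Coprime q M) (hMd : Nat.Coprime d M) :
    ∃ L U0, U0 < q ^ L ∧ ∀ τ : ℕ, ∃ U, U < q ^ L ∧ U ≡ τ [MOD M] ∧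
      ∀ n, Eqv q f (q ^ L * n + U) (q ^ L * n + U0) := by
  obtain ⟨c, hc⟩ : ∃ c, Nat.totient M = c + 1 :=
    ⟨Nat.totient M - 1, by have := Nat.totient_pos.2 hM; omega⟩
  set lam := l * Nat.totient M with hlam
  have hle : l ≤ lam := by rw [hlam, hc]; nlinarith [Nat.zero_le (l * c)]
  have hpow : q ^ l ≤ q ^ lam := Nat.pow_le_pow_right (by omega) hle
  have hact' : ∀ n, Eqv q f (q ^ lam * n + r) (q ^ lam * n + (r + d)) := by
    intro n
    have h := hact (q ^ (lam - l) * n)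
    have e : q ^ lam = q ^ l * q ^ (lam - l) := by rw [← pow_add]; congr 1; omega
    rw [e, mul_assoc]; exact h
  have hone : q ^ lam ≡ 1 [MOD M] := by
    rw [hlam, mul_comm, pow_mul]
    simpa using (Nat.ModEq.pow_totient hMq).pow l
  have key : ∀ K : ℕ, ∃ U0, U0 < q ^ (lam * K) ∧ ∀ j ≤ K, ∃ U, U < q ^ (lam * K) ∧
      U ≡ U0 + j * d [MOD M] ∧
      ∀ n, Eqv q f (q ^ (lam * K) * n + U) (q ^ (lam * K) * n + U0) := by
    intro K
    induction K with
    | zero =>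
      refine ⟨0, by simp, fun j hj => ⟨0, by simp, ?_, fun n => Eqv.refl _⟩⟩
      have : j = 0 := by omega
      subst this; simp; rfl
    | succ K ih =>
      obtain ⟨U0, hU0, h⟩ := ih
      have hr : r < q ^ lam := by omega
      have hr' : r + d < q ^ lam := by omega
      have e : lam * (K + 1) = lam * K + lam := by ring
      rw [e]
      refine ⟨q ^ lam * U0 + r, word_lt hU0 hr, ?_⟩
      intro j hj
      rcases Nat.lt_or_ge K j with hj' | hj'
      · have hjK : j = K + 1 := by omega
        obtain ⟨U, hU, hmod, hE⟩ := h K le_rfl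
        refine ⟨q ^ lam * U + (r + d), word_lt hU hr', ?_, ?_⟩
        · have h1 : q ^ lam * U ≡ 1 * (U0 + K * d) [MOD M] := hone.mul hmod
          have h2 : q ^ lam * U0 ≡ 1 * U0 [MOD M] := hone.mul_right _
          have h3 := h1.add_right (r + d)
          have h4 := (h2.add_right (r + j * d)).symm
          have e3 : 1 * (U0 + K * d) + (r + d) = 1 * U0 + (r + j * d) := by rw [hjK]; ring
          rw [e3] at h3
          rw [add_assoc]
          exact h3.trans h4
        · intro n
          rw [← word_app, ← word_app]
          exact (hact' _).symm.trans ((hE n).app hr)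
      · obtain ⟨U, hU, hmod, hE⟩ := h j hj'
        refine ⟨q ^ lam * U + r, word_lt hU hr, ?_, ?_⟩
        · have h1 : q ^ lam * U ≡ 1 * (U0 + j * d) [MOD M] := hone.mul hmod
          have h2 : q ^ lam * U0 ≡ 1 * U0 [MOD M] := hone.mul_right _
          have h3 := h1.add_right r
          have h4 := (h2.add_right (r + j * d)).symm
          have e3 : 1 * (U0 + j * d) + r = 1 * U0 + (r + j * d) := by ring
          rw [e3] at h3
          rw [add_assoc]
          exact h3.trans h4
        · intro n
          rw [← word_app, ← word_app]
          exact (hE n).app hr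
  obtain ⟨U0, hU0, h⟩ := key M
  refine ⟨lam * M, U0, hU0, fun τ => ?_⟩
  have : NeZero M := ⟨hM.ne'⟩
  let x : ZMod M := ((τ : ZMod M) - U0) * (d : ZMod M)⁻¹
  obtain ⟨U, hU, hmod, hE⟩ := h x.val (ZMod.val_lt x).le
  refine ⟨U, hU, ?_, hE⟩
  rw [← ZMod.natCast_eq_natCast_iff] at hmod ⊢
  rw [hmod]
  push_cast
  rw [ZMod.natCast_zmod_val]
  simp only [x]
  rw [mul_assoc, mul_comm _ (d : ZMod M), ZMod.coe_mul_inv_eq_one _ hMd]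
  ring

/-- key shift lemma -/
theorem shift (hq : 2 ≤ q)
    (hmul : ∀ m n : ℕ, Nat.Coprime m n → f (m * n) = f m * f n)
    {l r d : ℕ} (hrd : r + d < q ^ l)
    (hact : ∀ n, Eqv q f (q ^ l * n + r) (q ^ l * n + (r + d)))
    {t w : ℕ} (hw : w < q ^ t)
    (hper : ∀ n m i u, u < q ^ i →
      Eqv q f (q ^ i * (q ^ t * n + w) + u) (q ^ i * (q ^ t * m + w) + u) →
      Eqv q f (q ^ t * n + w) (q ^ t * m + w))
    {n D : ℕ} (hn : Eqv q f n (n + D))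
    {a : ℕ} (ha : 0 < a) (ha2 : Nat.Coprime a 2) (haq : Nat.Coprime a q)
    (had : Nat.Coprime a d) (haD : Nat.Coprime a D)
    {e : ℕ} (he : e < a) :
    Eqv q f (q ^ t * (a * n + e) + w) (q ^ t * (a * (n + D) + e) + w) := by
  by_contra hne
  obtain ⟨L, U0, hU0, htune⟩ := tune hq hrd hact (M := a ^ 2) (by positivity)
    (haq.symm.pow_right 2) (had.symm.pow_right 2)
  have h1 : ¬ Eqv q f (q ^ L * (q ^ t * (a * n + e) + w) + U0)
      (q ^ L * (q ^ t * (a * (n + D) + e) + w) + U0) :=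
    fun h => hne (hper _ _ _ _ hU0 h)
  unfold Eqv at h1
  push Not at h1
  obtain ⟨k, u, hu, hfu⟩ := h1
  set T := t + L + k with hT
  have : NeZero (a ^ 2) := ⟨by positivity⟩
  let y : ZMod (a ^ 2) := ((a * (q ^ T * (D + (a - 1 : ℕ) * n)) : ℕ) - (q ^ T * e : ℕ) -
    (q ^ (L + k) * w : ℕ) - (u : ℕ)) * ((q ^ k : ℕ) : ZMod (a ^ 2))⁻¹
  obtain ⟨U, hU, hmod, hE⟩ := htune y.val
  set s := q ^ k * (q ^ L * w + U) + u with hs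
  have hslt : s < q ^ T := by
    rw [hs, hT]
    exact word_lt (word_lt hw hU) hu
  have hmods : q ^ T * e + s ≡ a * (q ^ T * (D + (a - 1 : ℕ) * n)) [MOD a ^ 2] := by
    rw [← ZMod.natCast_eq_natCast_iff] at hmod ⊢
    rw [ZMod.natCast_zmod_val] at hmod
    have hk1 : ((q ^ k : ℕ) : ZMod (a ^ 2)) * ((q ^ k : ℕ) : ZMod (a ^ 2))⁻¹ = 1 :=
      ZMod.coe_mul_inv_eq_one _ ((haq.symm.pow_left k).pow_right 2)
    have h3 : ((q ^ k : ℕ) : ZMod (a ^ 2)) * U =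
      ((a * (q ^ T * (D + (a - 1 : ℕ) * n)) : ℕ) - (q ^ T * e : ℕ) -
        (q ^ (L + k) * w : ℕ) - (u : ℕ)) := by
      rw [hmod]; simp only [y]
      rw [mul_comm, mul_assoc, mul_comm _ ((q ^ k : ℕ) : ZMod (a ^ 2)), hk1, mul_one]
    have h4 : q ^ T * e + s = q ^ T * e + q ^ (L + k) * w + u + q ^ k * U := by
      rw [hs]; ring
    rw [h4, Nat.cast_add _ (q ^ k * U), Nat.cast_mul (q ^ k) U, h3]
    push_cast; ring
  have hdvd : a ∣ q ^ T * e + s := by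
    have : q ^ T * e + s ≡ a * (q ^ T * (D + (a - 1 : ℕ) * n)) [MOD a] :=
      hmods.of_dvd (Dvd.intro_left (a ^ 1) (by ring))
    exact (this.dvd_iff dvd_rfl).2 (Dvd.intro _ rfl)
  obtain ⟨ρ, hρ⟩ := hdvd
  have hρmod : ρ ≡ q ^ T * (D + (a - 1 : ℕ) * n) [MOD a] := by
    rw [hρ, pow_two] at hmods
    exact Nat.ModEq.mul_left_cancel' ha.ne' hmods
  have hρlt : ρ < q ^ T := by
    have : a * ρ < a * q ^ T := by
      rw [← hρ]
      calc q ^ T * e + s < q ^ T * e + q ^ T := by omega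
        _ = q ^ T * (e + 1) := by ring
        _ ≤ q ^ T * a := Nat.mul_le_mul_left _ he
        _ = a * q ^ T := by ring
    exact lt_of_mul_lt_mul_left this (Nat.zero_le _)
  have hx1 : q ^ T * n + ρ ≡ q ^ T * D [MOD a] := by
    have h := hρmod.add_left (q ^ T * n)
    have e1 : q ^ T * n + q ^ T * (D + (a - 1) * n) = q ^ T * D + a * (q ^ T * n) := by
      obtain ⟨b, rfl⟩ : ∃ b, a = b + 1 := ⟨a - 1, by omega⟩
      simp; ring
    rw [e1] at h
    exact h.trans (by simp [Nat.ModEq])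
  have hx2 : q ^ T * (n + D) + ρ ≡ 2 * (q ^ T * D) [MOD a] := by
    have h := hx1.add_left (q ^ T * D)
    have e1 : q ^ T * D + (q ^ T * n + ρ) = q ^ T * (n + D) + ρ := by ring
    rw [e1] at h
    rwa [two_mul]
  have hcop : Nat.Coprime a (q ^ T * D) := (haq.pow_right T).mul_right haD
  have hc1 : Nat.Coprime a (q ^ T * n + ρ) := by
    rw [Nat.Coprime, Nat.gcd_comm, hx1.gcd_eq, Nat.gcd_comm]; exact hcop
  have hc2 : Nat.Coprime a (q ^ T * (n + D) + ρ) := by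
    rw [Nat.Coprime, Nat.gcd_comm, hx2.gcd_eq, Nat.gcd_comm]; exact ha2.mul_right hcop
  have hz1 : q ^ k * (q ^ L * (q ^ t * (a * n + e) + w) + U) + u = a * (q ^ T * n + ρ) := by
    rw [mul_add a, ← hρ, hs, hT]; ring
  have hz2 : q ^ k * (q ^ L * (q ^ t * (a * (n + D) + e) + w) + U) + u =
      a * (q ^ T * (n + D) + ρ) := by
    rw [mul_add a (q ^ T * (n + D)), ← hρ, hs, hT]; ring
  apply hfu
  rw [← hE _ k u hu, ← hE _ k u hu, hz1, hz2, hmul _ _ hc1, hmul _ _ hc2, hn T ρ hρlt]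

/-- local periodicity on long intervals -/
theorem local_period (hq : 2 ≤ q)
    (hmul : ∀ m n : ℕ, Nat.Coprime m n → f (m * n) = f m * f n)
    [Finite (Quotient (sd q f))] :
    ∃ t w m Y, w < q ^ t ∧ Nat.Coprime w q ∧ 0 < m ∧ 0 < Y ∧ ∀ X, ∃ T ≥ X,
      ∀ z, z + m < q ^ T → f (q ^ t * (q ^ T * Y + z) + w) = f (q ^ t * (q ^ T * Y + (z + m)) + w) := by
  obtain ⟨l, r, d, hd, hrd, hact⟩ := same_action (f := f) hq
  obtain ⟨t, w, ht, hw, hwq, hper⟩ := persist (f := f) hq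
  obtain ⟨n, D, hD, hn⟩ : ∃ n D, 0 < D ∧ Eqv q f n (n + D) := by
    obtain ⟨a, b, hab, h⟩ := Finite.exists_ne_map_eq_of_infinite (Quotient.mk (sd q f))
    rcases lt_or_gt_of_ne hab with h' | h'
    · refine ⟨a, b - a, by omega, ?_⟩
      rw [show a + (b - a) = b by omega]; exact mk_eq_iff.1 h
    · refine ⟨b, a - b, by omega, ?_⟩
      rw [show b + (a - b) = a by omega]; exact (mk_eq_iff.1 h).symm
  set P := 2 * q * d * D with hP
  have hPpos : 0 < P := by positivity
  have hsh : ∀ a, 0 < a → Nat.Coprime a P → ∀ e < a,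
      Eqv q f (q ^ t * (a * n + e) + w) (q ^ t * (a * (n + D) + e) + w) := by
    intro a ha haP e he
    have h1 : Nat.Coprime a 2 := haP.coprime_dvd_right ⟨q * d * D, by rw [hP]; ring⟩
    have h2 : Nat.Coprime a q := haP.coprime_dvd_right ⟨2 * d * D, by rw [hP]; ring⟩
    have h3 : Nat.Coprime a d := haP.coprime_dvd_right ⟨2 * q * D, by rw [hP]; ring⟩
    have h4 : Nat.Coprime a D := haP.coprime_dvd_right ⟨2 * q * d, by rw [hP]; ring⟩
    exact shift hq hmul hrd hact hw hper hn ha h1 h2 h3 h4 he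
  have hsh2 : ∀ a, 0 < a → Nat.Coprime a P → ∀ e, e + P * n < a →
      Eqv q f (q ^ t * (a * (n + D) + P * n + e) + w)
        (q ^ t * (a * (n + D) + P * n + e + P * D) + w) := by
    intro a ha haP e he
    have h1 := hsh a ha haP (P * n + e) (by omega)
    have h2 := hsh (a + P) (by omega) (by simpa using haP) e (by omega)
    have e1 : (a + P) * n + e = a * n + (P * n + e) := by ring
    have e2 : (a + P) * (n + D) + e = a * (n + D) + P * n + e + P * D := by ring
    have e3 : a * (n + D) + (P * n + e) = a * (n + D) + P * n + e := by ring
    rw [e1, e2] at h2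
    rw [e3] at h1
    exact h1.symm.trans h2
  have hT : ∀ T : ℕ, ∃ y, 0 < y ∧ ∀ z < q ^ T,
      Eqv q f (q ^ t * (q ^ T * y + z) + w) (q ^ t * (q ^ T * y + (z + P * D)) + w) := by
    intro T
    set a := P * (n + 2 * q ^ T + 1) + 1 with ha
    have hqT : 0 < q ^ T := by positivity
    have haP : Nat.Coprime a P := by rw [ha]; simp
    set b := a * (n + D) + P * n with hb
    refine ⟨b / q ^ T + 1, Nat.succ_pos _, fun z hz => ?_⟩
    have h1 := Nat.div_add_mod b (q ^ T)
    have h2 := Nat.mod_lt b hqT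
    generalize b % q ^ T = y0 at h1 h2
    obtain ⟨e, he⟩ : ∃ e, q ^ T * (b / q ^ T + 1) + z = b + e :=
      ⟨q ^ T - y0 + z, by rw [mul_add]; omega⟩
    have he2 : e < 2 * q ^ T := by rw [mul_add] at he; omega
    have hsmall : e + P * n < a := by
      rw [ha]; nlinarith
    have := hsh2 a (by omega) haP e hsmall
    rw [← add_assoc, he]
    exact this
  choose y hy hyT using hT
  obtain ⟨c, hc⟩ := Finite.exists_infinite_fiber (fun T => Quotient.mk (sd q f) (y T))
  have hcinf : ((fun T => Quotient.mk (sd q f) (y T)) ⁻¹' {c}).Infinite := Set.infinite_coe_iff.1 hc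
  obtain ⟨T0, hT0⟩ := hcinf.nonempty
  refine ⟨t, w, P * D, y T0, hw, hwq, by positivity, hy T0, fun X => ?_⟩
  obtain ⟨T, hTm, hTX⟩ := hcinf.exists_gt X
  refine ⟨T, hTX.le, fun z hz => ?_⟩
  have hE : Eqv q f (y T) (y T0) := by
    apply mk_eq_iff.1
    have h1 : Quotient.mk (sd q f) (y T) = c := hTm
    have h2 : Quotient.mk (sd q f) (y T0) = c := hT0
    rw [h1, h2]
  have h1 := (((hE.app (i := T) (r := z) (by omega)).app hw))
  have h2 := (((hE.app (i := T) (r := z + P * D) (by omega)).app hw))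
  exact (h1.symm.trans ((hyT T z (by omega)).trans h2)).val

theorem mk_char {Q : ℕ} (hQ : 1 < Q) (hf1 : f 1 = 1)
    (hne : ∀ a, Nat.Coprime a Q → f a ≠ 0)
    (hper : ∀ a b, Nat.Coprime a Q → a ≡ b [MOD Q] → f a = f b)
    (hmul : ∀ a b, Nat.Coprime a Q → Nat.Coprime b Q → f (a * b) = f a * f b) :
    ∃ χ : DirichletCharacter ℂ Q, ∀ n : ℕ, Nat.Coprime n Q → f n = χ (n : ZMod Q) := by
  have : NeZero Q := ⟨by omega⟩
  have hcop : ∀ u : (ZMod Q)ˣ, Nat.Coprime (u : ZMod Q).val Q := fun u => ZMod.val_coe_unit_coprime u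
  let g : (ZMod Q)ˣ →* ℂˣ :=
    { toFun := fun u => Units.mk0 (f (u : ZMod Q).val) (hne _ (hcop u))
      map_one' := by
        ext
        have : Fact (1 < Q) := ⟨hQ⟩
        simp [ZMod.val_one, hf1]
      map_mul' := by
        intro u v
        ext
        simp only [Units.val_mul, Units.val_mk0]
        rw [← hmul _ _ (hcop u) (hcop v)]
        refine hper _ _ ?_ ?_
        · have := hcop (u * v); simpa using this
        · rw [ZMod.val_mul]; exact Nat.mod_modEq _ _ }
  refine ⟨MulChar.ofUnitHom g, fun n hn => ?_⟩
  have hu : (n : ZMod Q) = (ZMod.unitOfCoprime n hn : ZMod Q) := by simp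
  rw [hu, MulChar.ofUnitHom_coe]
  simp only [g, MonoidHom.coe_mk, OneHom.coe_mk, Units.val_mk0]
  refine hper _ _ hn ?_
  rw [ZMod.coe_unitOfCoprime, ZMod.val_natCast]
  exact (Nat.mod_modEq _ _).symm

set_option maxHeartbeats 2000000 in
theorem partB (hq : 2 ≤ q)
    (hmul : ∀ m n : ℕ, Nat.Coprime m n → f (m * n) = f m * f n)
    [Finite (Quotient (sd q f))] {P0 : ℕ} (hP0 : 0 < P0)
    (hne : ∀ n, 0 < n → Nat.Coprime n P0 → f n ≠ 0) :
    ∃ (Q : ℕ) (χ : DirichletCharacter ℂ Q), 1 ≤ Q ∧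
      (∀ n : ℕ, 0 < n → Nat.Coprime n Q → f n = χ (n : ZMod Q)) := by
  obtain ⟨t, w, m, Y, hw, hwq, hm, hY, hper⟩ := local_period hq hmul
  set Q := q ^ t * m * P0 * q with hQ
  have hqt : 0 < q ^ t := by positivity
  have hQ1 : 1 < Q := by
    have : 0 < q ^ t * m * P0 := by positivity
    rw [hQ]; nlinarith
  have hpos : ∀ a, Nat.Coprime a Q → 0 < a := by
    intro a ha
    rcases Nat.eq_zero_or_pos a with rfl | h
    · simp at ha; omega
    · exact h
  have hne' : ∀ a, Nat.Coprime a Q → f a ≠ 0 := fun a ha => hne a (hpos a ha)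
    (ha.coprime_dvd_right ⟨q ^ t * m * q, by rw [hQ]; ring⟩)
  have hf1 : f 1 = 1 := by
    have h1 := hmul 1 1 (by simp)
    have h2 := hne' 1 (by simp)
    simp only [mul_one] at h1
    exact (mul_left_cancel₀ h2 (by rw [mul_one]; exact h1)).symm
  have hper2 : ∀ X, ∃ T ≥ X, ∀ k z, z + m * k < q ^ T →
      f (q ^ t * (q ^ T * Y + z) + w) = f (q ^ t * (q ^ T * Y + (z + m * k)) + w) := by
    intro X
    obtain ⟨T, hT, h⟩ := hper X
    refine ⟨T, hT, fun k => ?_⟩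
    induction k with
    | zero => intro z _; simp
    | succ k ih =>
      intro z hz
      have e : z + m * (k + 1) = z + m * k + m := by ring
      rw [e] at hz ⊢
      rw [ih z (by omega), h _ hz]
  have hstep : ∀ a, Nat.Coprime a Q → Q * Y < a → f a = f (a + Q) := by
    intro a ha haY
    have hapos := hpos a ha
    have ha' : Nat.Coprime (a + Q) Q := by simpa using ha
    have haqt : Nat.Coprime a (q ^ t) := ha.coprime_dvd_right ⟨m * P0 * q, by rw [hQ]; ring⟩
    have : NeZero (q ^ t) := ⟨hqt.ne'⟩
    set V := Q * a * (a + Q) with hV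
    have hVpos : 0 < V := by positivity
    obtain ⟨M0, hM0V, hM0p, hM0⟩ := Nat.forall_exists_prime_gt_and_eq_mod (q := q ^ t)
      (a := (w : ZMod (q ^ t)) * (a : ZMod (q ^ t))⁻¹) (by
        apply IsUnit.mul
        · exact (ZMod.isUnit_iff_coprime _ _).2 (hwq.pow_right t)
        · exact IsUnit.of_mul_eq_one (a : ZMod (q ^ t)) (by
            rw [mul_comm]; exact ZMod.coe_mul_inv_eq_one _ haqt)) V
    have hM0c : Nat.Coprime M0 V := by
      rw [hM0p.coprime_iff_not_dvd]
      exact fun h => absurd (Nat.le_of_dvd hVpos h) (by omega)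
    have hM0a : M0 * a ≡ w [MOD q ^ t] := by
      rw [← ZMod.natCast_eq_natCast_iff]
      push_cast
      rw [hM0, mul_assoc, mul_comm _ (a : ZMod (q ^ t)), ZMod.coe_mul_inv_eq_one _ haqt, mul_one]
    obtain ⟨T, hT, hperT⟩ := hper2 (V * a * (a + Q) + M0 * a)
    set X := q ^ t * q ^ T with hX
    have hXT : T < X := by
      calc T < q ^ T := Nat.lt_pow_self (by omega)
        _ ≤ X := by rw [hX]; exact Nat.le_mul_of_pos_left _ hqt
    have hex : ∃ j, X * Y ≤ (M0 + j * V) * a := ⟨X * Y, by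
      have : 0 < V * a := by positivity
      nlinarith [Nat.zero_le (M0 * a), Nat.zero_le (X * Y)]⟩
    classical
    obtain ⟨j, hj, hjmin⟩ : ∃ j, X * Y ≤ (M0 + j * V) * a ∧ (M0 + j * V) * a < X * Y + V * a := by
      have hj := Nat.find_spec hex
      set j := Nat.find hex with hjd
      refine ⟨j, hj, ?_⟩
      rcases Nat.eq_zero_or_pos j with h0 | h0
      · rw [h0]
        have : 0 < V * a := by positivity
        have : X ≤ X * Y := Nat.le_mul_of_pos_right _ hY
        have : 0 ≤ V * a * (a + Q) := by positivity
        simp only [zero_mul, add_zero]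
        omega
      · have := Nat.find_min hex (m := j - 1) (by omega)
        push Not at this
        obtain ⟨i, hi⟩ : ∃ i, j = i + 1 := ⟨j - 1, by omega⟩
        rw [hi] at this ⊢
        simp only [Nat.add_sub_cancel] at this
        nlinarith
    set M := M0 + j * V with hM
    have hMc : Nat.Coprime M V := by
      rw [hM]; simpa using hM0c
    have hMa : Nat.Coprime M a := hMc.coprime_dvd_right ⟨Q * (a + Q), by rw [hV]; ring⟩
    have hMa' : Nat.Coprime M (a + Q) := hMc.coprime_dvd_right ⟨Q * a, by rw [hV]; ring⟩
    have hMQ : Nat.Coprime M Q := hMc.coprime_dvd_right ⟨a * (a + Q), by rw [hV]; ring⟩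
    have hMamod : M * a ≡ w [MOD q ^ t] := by
      have : M * a = M0 * a + q ^ t * (j * m * P0 * q * a * (a + Q) * a) := by
        rw [hM, hV]; simp only [hQ]; ring
      rw [this]
      exact (show M0 * a + q ^ t * _ ≡ M0 * a [MOD q ^ t] by simp [Nat.ModEq]).trans hM0a
    have hup : M * (a + Q) < X * (Y + 1) := by
      have h1 : M * a * (a + Q) < (X * Y + V * a) * (a + Q) :=
        Nat.mul_lt_mul_of_pos_right hjmin (by omega)
      have h2 : (X * Y + V * a) * (a + Q) ≤ X * (Y + 1) * a := by
        have h3 : V * a * (a + Q) ≤ X := by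
          have : 0 ≤ M0 * a := by positivity
          omega
        have h4 : X * (Q * Y + 1) ≤ X * a := Nat.mul_le_mul_left _ haY
        calc (X * Y + V * a) * (a + Q) = X * Y * a + X * Y * Q + V * a * (a + Q) := by ring
          _ ≤ X * Y * a + X * Y * Q + X := Nat.add_le_add_left h3 _
          _ = X * Y * a + X * (Q * Y + 1) := by ring
          _ ≤ X * Y * a + X * a := Nat.add_le_add_left h4 _
          _ = _ := by ring
      have h5 : M * (a + Q) * a < X * (Y + 1) * a := by
        calc M * (a + Q) * a = M * a * (a + Q) := by ring
          _ < _ := h1.trans_le h2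
      exact lt_of_mul_lt_mul_right h5 (Nat.zero_le _)
    have hmoda : (M * a) % q ^ t = w := by rw [hMamod, Nat.mod_eq_of_lt hw]
    have hdm := Nat.div_add_mod (M * a) (q ^ t)
    rw [hmoda] at hdm
    have hzle : q ^ T * Y ≤ M * a / q ^ t := by
      rw [Nat.le_div_iff_mul_le hqt]
      calc q ^ T * Y * q ^ t = X * Y := by rw [hX]; ring
        _ ≤ _ := hj
    obtain ⟨z, hz⟩ := Nat.exists_eq_add_of_le hzle
    have hN : M * a = q ^ t * (q ^ T * Y + z) + w := by rw [← hz, hdm]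
    set k := M * P0 * q with hk
    have hN' : M * (a + Q) = q ^ t * (q ^ T * Y + (z + m * k)) + w := by
      rw [mul_add, hN, hQ, hk]; ring
    have hzk : z + m * k < q ^ T := by
      have h1 : q ^ t * (q ^ T * Y + (z + m * k)) < q ^ t * (q ^ T * (Y + 1)) := by
        calc q ^ t * (q ^ T * Y + (z + m * k)) ≤ M * (a + Q) := by rw [hN']; omega
          _ < X * (Y + 1) := hup
          _ = _ := by rw [hX]; ring
      have h2 := lt_of_mul_lt_mul_left h1 (Nat.zero_le _)
      rw [mul_add (q ^ T)] at h2
      omega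
    have hfin := hperT k z hzk
    rw [← hN, ← hN', hmul _ _ hMa, hmul _ _ hMa'] at hfin
    exact mul_left_cancel₀ (hne' M hMQ) hfin
  have hstep2 : ∀ k a, Nat.Coprime a Q → Q * Y < a → f a = f (a + k * Q) := by
    intro k
    induction k with
    | zero => intro a _ _; simp
    | succ k ih =>
      intro a ha h
      rw [ih a ha h, hstep (a + k * Q) (by simpa using ha) (by omega)]
      congr 1; ring
  have hperadd : ∀ a k, Nat.Coprime a Q → f a = f (a + k * Q) := by
    intro a k ha
    have hapos := hpos a ha
    have ha' : Nat.Coprime (a + k * Q) Q := by simpa using ha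
    set M := 1 + (Q * Y + 1) * Q * a * (a + k * Q) with hM
    have hMa : Nat.Coprime M a := by
      rw [hM, show (1 + (Q * Y + 1) * Q * a * (a + k * Q)) =
        1 + ((Q * Y + 1) * Q * (a + k * Q)) * a by ring]
      simp
    have hMa' : Nat.Coprime M (a + k * Q) := by
      rw [hM]; simp
    have hMQ : Nat.Coprime M Q := by
      rw [hM, show (1 + (Q * Y + 1) * Q * a * (a + k * Q)) =
        1 + ((Q * Y + 1) * a * (a + k * Q)) * Q by ring]
      simp
    have hbig : Q * Y < M * a := by
      have h1 : 1 ≤ Q * a * (a + k * Q) := Nat.one_le_iff_ne_zero.2 (by positivity)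
      have h2 : (Q * Y + 1) * 1 ≤ (Q * Y + 1) * (Q * a * (a + k * Q)) := Nat.mul_le_mul_left _ h1
      have h3 : M ≤ M * a := Nat.le_mul_of_pos_right _ hapos
      have h4 : M = 1 + (Q * Y + 1) * (Q * a * (a + k * Q)) := by rw [hM]; ring
      omega
    have := hstep2 (M * k) (M * a) (hMQ.mul_left ha) hbig
    rw [show M * a + M * k * Q = M * (a + k * Q) by ring, hmul _ _ hMa, hmul _ _ hMa'] at this
    exact mul_left_cancel₀ (hne' M hMQ) this
  have hperiod : ∀ a b, Nat.Coprime a Q → a ≡ b [MOD Q] → f a = f b := by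
    have aux : ∀ a b, a ≤ b → Nat.Coprime a Q → a ≡ b [MOD Q] → f a = f b := by
      intro a b hab ha h
      obtain ⟨k, hk⟩ := (Nat.modEq_iff_dvd' hab).1 h
      have : b = a + k * Q := by rw [mul_comm k]; omega
      rw [this]; exact hperadd a k ha
    intro a b ha h
    rcases le_total a b with hab | hab
    · exact aux a b hab ha h
    · refine (aux b a hab ?_ h.symm).symm
      rw [Nat.Coprime, ← h.gcd_eq]; exact ha
  have hcm : ∀ a b, Nat.Coprime a Q → Nat.Coprime b Q → f (a * b) = f a * f b := by
    intro a b ha hb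
    obtain ⟨p, hpa, hpp, hpb⟩ := Nat.forall_exists_prime_gt_and_modEq a (q := Q) (by omega) hb
    have hap : Nat.Coprime a p := by
      rw [Nat.coprime_comm, hpp.coprime_iff_not_dvd]
      exact fun h => absurd (Nat.le_of_dvd (hpos a ha) h) (by omega)
    rw [hperiod _ _ (ha.mul_left hb) (hpb.symm.mul_left a), hmul _ _ hap, hperiod b p hb hpb.symm]
  obtain ⟨χ, hχ⟩ := mk_char hQ1 hf1 hne' hperiod hcm
  exact ⟨Q, χ, by omega, fun n _ hn => hχ n hn⟩

end partB

section partA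
variable {q : ℕ} {f : ℕ → ℂ}

theorem dense_aux {q p : ℕ} (hq : 2 ≤ q) (hp : p.Prime) (hpq : q < p) {a b : ℝ} (hab : a < b) :
    ∃ (j : ℕ) (k : ℤ), a < j * Real.log p + k * Real.log q ∧
      j * Real.log p + k * Real.log q < b := by
  have hlq : 0 < Real.log q := Real.log_pos (by exact_mod_cast (by omega : 1 < q))
  have hlp : 0 < Real.log p := Real.log_pos (by exact_mod_cast (by omega : 1 < p))
  have hirr : Irrational (Real.log p / Real.log q) := by
    rintro ⟨x, hx⟩
    have hxpos : 0 < x := by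
      have : (0:ℝ) < x := by rw [hx]; positivity
      exact_mod_cast this
    have hnum : 0 < x.num := Rat.num_pos.2 hxpos
    obtain ⟨c, hc⟩ : ∃ c : ℕ, x.num = c := ⟨x.num.toNat, by omega⟩
    have hx' : (c : ℝ) / x.den = Real.log p / Real.log q := by
      rw [← hx, Rat.cast_def, hc]; simp
    have hden : (0:ℝ) < x.den := by exact_mod_cast x.den_pos
    rw [div_eq_div_iff hden.ne' hlq.ne'] at hx'
    have h2 : Real.log ((q : ℝ) ^ c) = Real.log ((p : ℝ) ^ x.den) := by
      rw [Real.log_pow, Real.log_pow, hx']; ring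
    have h3 : (q : ℝ) ^ c = (p : ℝ) ^ x.den :=
      Real.log_injOn_pos (Set.mem_Ioi.2 (by positivity))
        (Set.mem_Ioi.2 (pow_pos (by exact_mod_cast hp.pos) _)) h2
    have h4 : q ^ c = p ^ x.den := by exact_mod_cast h3
    have h5 : p ∣ q ^ c := by rw [h4]; exact dvd_pow_self _ x.den_pos.ne'
    exact absurd (Nat.le_of_dvd (by omega) (hp.dvd_of_dvd_pow h5)) (by omega)
  have : Fact (0 < Real.log q) := ⟨hlq⟩
  have hd : DenseRange (· • ((Real.log p : ℝ) : AddCircle (Real.log q)) :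
      ℤ → AddCircle (Real.log q)) := AddCircle.denseRange_zsmul_coe_iff.2 hirr
  rw [denseRange_zsmul_iff_nsmul] at hd
  have hopen : IsOpen ((fun x : ℝ => (x : AddCircle (Real.log q))) '' Set.Ioo a b) :=
    QuotientAddGroup.isOpenMap_coe _ isOpen_Ioo
  obtain ⟨j, c, hc, hj⟩ := hd.exists_mem_open hopen ⟨_, (a + b) / 2, ⟨by linarith, by linarith⟩, rfl⟩
  have h1 : ((c : ℝ) : AddCircle (Real.log q)) = ((j * Real.log p : ℝ) : AddCircle (Real.log q)) := by
    simp only at hj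
    rw [hj, ← AddCircle.coe_nsmul, nsmul_eq_mul]
  have h2 := (QuotientAddGroup.eq).1 h1
  obtain ⟨k, hk⟩ := AddSubgroup.mem_zmultiples_iff.1 h2
  rw [zsmul_eq_mul] at hk
  refine ⟨j, -k, ?_, ?_⟩
  · push_cast
    linarith [hc.1]
  · push_cast
    linarith [hc.2]

/-- number of nonvanishing continuations -/
noncomputable def cnt (q : ℕ) (f : ℕ → ℂ) (m i : ℕ) : ℕ := by
  classical exact ((Finset.range (q ^ i)).filter (fun r => f (q ^ i * m + r) ≠ 0)).card

/-- unboundedly many nonvanishing continuations of equal length -/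
def Rich (q : ℕ) (f : ℕ → ℂ) (m : ℕ) : Prop := ∀ B, ∃ i, B ≤ cnt q f m i

theorem cnt_congr {n m : ℕ} (h : Eqv q f n m) (i : ℕ) : cnt q f n i = cnt q f m i := by
  classical
  unfold cnt
  congr 1
  apply Finset.filter_congr
  intro r hr
  rw [h i r (Finset.mem_range.1 hr)]

theorem dead (hq : 2 ≤ q)
    (hmul : ∀ m n : ℕ, Nat.Coprime m n → f (m * n) = f m * f n)
    [Finite (Quotient (sd q f))]
    (hinf : {p : ℕ | p.Prime ∧ ∃ e, f (p ^ e) = 0}.Infinite) :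
    ∃ m, 0 < m ∧ ∀ i r, r < q ^ i → f (q ^ i * m + r) = 0 := by
  classical
  obtain ⟨C, hC⟩ := bound (q := q) (f := f) (fun n i => ∃ r, r < q ^ i ∧ f (q ^ i * n + r) ≠ 0) (by
    rintro n m i h ⟨r, hr, hf⟩
    exact ⟨r, hr, by rwa [← h i r hr]⟩)
  have key : ∀ I : Finset (ℕ × ℕ), ∃ m0 V, 0 < V ∧ ∀ m, m ≡ m0 [MOD V] →
      ∀ x ∈ I, f (q ^ x.1 * m + x.2) = 0 := by
    intro I
    induction I using Finset.induction_on with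
    | empty => exact ⟨0, 1, by simp, by simp⟩
    | insert x I hx ih =>
      obtain ⟨m0, V, hV, h⟩ := ih
      obtain ⟨p, ⟨hp, e, he⟩, hpV⟩ := hinf.exists_gt (q * V)
      have hpos : 0 < q * V := by positivity
      have hcop : Nat.Coprime p (q * V) := by
        rw [hp.coprime_iff_not_dvd]
        exact fun h => absurd (Nat.le_of_dvd hpos h) (by omega)
      have hpq : Nat.Coprime (q ^ x.1) (p ^ (e + 1)) :=
        (Nat.Coprime.coprime_mul_right_right hcop).symm.pow _ _
      have hcV : Nat.Coprime V (p ^ (e + 1)) :=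
        (Nat.Coprime.coprime_mul_left_right hcop).symm.pow_right _
      have : NeZero (p ^ (e + 1)) := ⟨(pow_pos hp.pos _).ne'⟩
      let y : ZMod (p ^ (e + 1)) := ((p ^ e : ℕ) - (x.2 : ℕ)) * ((q ^ x.1 : ℕ) : ZMod (p ^ (e+1)))⁻¹
      have hy : q ^ x.1 * y.val + x.2 ≡ p ^ e [MOD p ^ (e + 1)] := by
        rw [← ZMod.natCast_eq_natCast_iff, Nat.cast_add, Nat.cast_mul, ZMod.natCast_zmod_val]
        simp only [y]
        rw [mul_comm, mul_assoc, mul_comm _ ((q ^ x.1 : ℕ) : ZMod (p ^ (e + 1))),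
          ZMod.coe_mul_inv_eq_one _ hpq]
        ring
      obtain ⟨k, hk1, hk2⟩ := Nat.chineseRemainder hcV m0 y.val
      refine ⟨k, V * p ^ (e + 1), Nat.mul_pos hV (pow_pos hp.pos _), fun m hm z hz => ?_⟩
      rcases Finset.mem_insert.1 hz with rfl | hz
      · have hm2 : m ≡ y.val [MOD p ^ (e + 1)] := (hm.of_dvd (Dvd.intro_left _ rfl)).trans hk2
        have h3 := ((hm2.mul_left (q ^ z.1)).add_right z.2).trans hy
        set N := q ^ z.1 * m + z.2 with hN
        have hd : p ^ e ∣ N := (h3.of_dvd (pow_dvd_pow p (Nat.le_succ e))).dvd_iff dvd_rfl |>.2 dvd_rfl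
        obtain ⟨c, hc⟩ := hd
        have hcp : Nat.Coprime (p ^ e) c := by
          apply Nat.Coprime.pow_left
          rw [hp.coprime_iff_not_dvd]
          rintro ⟨g, rfl⟩
          have h5 : p ^ (e + 1) ∣ N := ⟨g, by rw [hc]; ring⟩
          have h6 := (h3.dvd_iff dvd_rfl).1 h5
          have h7 := (Nat.pow_dvd_pow_iff_le_right hp.one_lt).1 h6
          omega
        rw [hc, hmul _ _ hcp, he, zero_mul]
      · exact h m ((hm.of_dvd (Dvd.intro _ rfl)).trans hk1) z hz
  obtain ⟨m0, V, hV, h⟩ := key ((Finset.range (C + 1)).biUnion fun i =>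
    (Finset.range (q ^ i)).image fun r => (i, r))
  refine ⟨m0 + V, by omega, ?_⟩
  by_contra! hcon
  obtain ⟨i, r, hr, hf⟩ := hcon
  obtain ⟨i', hi', r', hr', hf'⟩ := hC (m0 + V) ⟨i, r, hr, hf⟩
  apply hf'
  refine h (m0 + V) (by simp [Nat.ModEq]) (i', r') ?_
  simp only [Finset.mem_biUnion, Finset.mem_range, Finset.mem_image]
  exact ⟨i', by omega, r', hr', rfl⟩

theorem rich_thresh [Finite (Quotient (sd q f))] :
    ∃ B0, ∀ m i, B0 ≤ cnt q f m i → Rich q f m := by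
  obtain ⟨C, hC⟩ := bound (q := q) (f := f) (fun n i => ∀ j, cnt q f n j < i) (by
    intro n m i h hn j
    rw [← cnt_congr h j]; exact hn j)
  refine ⟨C, fun m i hi => ?_⟩
  by_contra hr
  unfold Rich at hr
  push Not at hr
  obtain ⟨k, hk, h⟩ := hC m hr
  have := h i
  omega

theorem rich_len [Finite (Quotient (sd q f))] (B : ℕ) :
    ∃ C, ∀ m, Rich q f m → ∃ i ≤ C, B ≤ cnt q f m i := by
  obtain ⟨C, hC⟩ := bound (q := q) (f := f) (fun n i => B ≤ cnt q f n i) (by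
    intro n m i h hn
    rwa [← cnt_congr h i])
  exact ⟨C, fun m hm => hC m (hm B)⟩

theorem pigeon (hq : 2 ≤ q) {B0 : ℕ} (hB0 : ∀ m i, B0 ≤ cnt q f m i → Rich q f m)
    (S W : Finset ℕ) (i : ℕ) (hS : ∀ N ∈ S, f N ≠ 0 ∧ N / q ^ i ∈ W) (hW : W.Nonempty)
    (hc : W.card * B0 ≤ S.card) : ∃ b ∈ W, Rich q f b := by
  classical
  obtain ⟨b, hb, hcard⟩ := Finset.exists_le_card_fiber_of_mul_le_card_of_maps_to
    (f := fun N => N / q ^ i) (fun N hN => (hS N hN).2) hW hc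
  refine ⟨b, hb, hB0 b i (hcard.trans ?_)⟩
  unfold cnt
  have hqi : 0 < q ^ i := by positivity
  refine Finset.card_le_card_of_injOn (fun N => N % q ^ i) ?_ ?_
  · intro N hN
    have hN' := Finset.mem_filter.1 hN
    have h := Nat.div_add_mod N (q ^ i)
    rw [hN'.2] at h
    simp only [Finset.coe_filter, Finset.mem_range, Set.mem_ofPred_eq]
    refine ⟨Nat.mod_lt _ hqi, ?_⟩
    rw [h]; exact (hS N hN'.1).1
  · intro N hN M hM hNM
    have hN' := (Finset.mem_filter.1 hN).2
    have hM' := (Finset.mem_filter.1 hM).2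
    have h := Nat.div_add_mod N (q ^ i)
    have h' := Nat.div_add_mod M (q ^ i)
    simp only at hNM
    rw [hN', hNM] at h
    rw [hM'] at h'
    exact h.symm.trans h'

theorem cnt_set (m i : ℕ) : ∃ S : Finset ℕ, S.card = cnt q f m i ∧
    ∀ N ∈ S, f N ≠ 0 ∧ ∃ r < q ^ i, N = q ^ i * m + r := by
  classical
  refine ⟨((Finset.range (q ^ i)).filter (fun r => f (q ^ i * m + r) ≠ 0)).image
    (fun r => q ^ i * m + r), ?_, ?_⟩
  · rw [Finset.card_image_of_injective _ (add_right_injective _)]; rfl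
  · intro N hN
    obtain ⟨r, hr, rfl⟩ := Finset.mem_image.1 hN
    have := Finset.mem_filter.1 hr
    exact ⟨this.2, r, Finset.mem_range.1 this.1, rfl⟩

theorem rich_child (hq : 2 ≤ q) [Finite (Quotient (sd q f))] {m : ℕ} (hm : Rich q f m) :
    ∃ d < q, Rich q f (q * m + d) := by
  classical
  obtain ⟨B0, hB0⟩ := rich_thresh (q := q) (f := f)
  obtain ⟨i, hi⟩ := hm (q * B0 + 2)
  obtain ⟨S, hSc, hS⟩ := cnt_set (q := q) (f := f) m i
  have hi0 : i ≠ 0 := by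
    rintro rfl
    have : cnt q f m 0 ≤ 1 := by
      unfold cnt
      exact (Finset.card_filter_le _ _).trans (by simp)
    omega
  obtain ⟨j, rfl⟩ := Nat.exists_eq_succ_of_ne_zero hi0
  have hqj : 0 < q ^ j := by positivity
  obtain ⟨b, hb, hr⟩ := pigeon hq hB0 S ((Finset.range q).image fun d => q * m + d) j (by
      intro N hN
      obtain ⟨h1, r, hr, rfl⟩ := hS N hN
      refine ⟨h1, Finset.mem_image.2 ⟨r / q ^ j, ?_, ?_⟩⟩
      · rw [Finset.mem_range, Nat.div_lt_iff_lt_mul hqj]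
        rwa [pow_succ, mul_comm] at hr
      · rw [pow_succ, mul_assoc, Nat.mul_add_div hqj]) (by
      simp; omega) (by
      rw [hSc]
      have : ((Finset.range q).image fun d => q * m + d).card ≤ q :=
        Finset.card_image_le.trans (by simp)
      have := Nat.mul_le_mul_right B0 this
      omega)
  obtain ⟨d, hd, rfl⟩ := Finset.mem_image.1 hb
  exact ⟨d, Finset.mem_range.1 hd, hr⟩

theorem rich_mul (hq : 2 ≤ q) [Finite (Quotient (sd q f))]
    (hmul : ∀ m n : ℕ, Nat.Coprime m n → f (m * n) = f m * f n) :
    ∃ R, ∀ p, p.Prime → R < p → f p ≠ 0 → ∃ t, ∀ m, Rich q f m →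
      ∃ b, Rich q f b ∧ q ^ t * b ≤ p * m + q ^ t ∧ p * m < q ^ t * b + q ^ t := by
  classical
  obtain ⟨B0, hB0⟩ := rich_thresh (q := q) (f := f)
  obtain ⟨C, hC⟩ := rich_len (q := q) (f := f) (2 * B0 + 1)
  refine ⟨q ^ C, fun p hp hpR hfp => ⟨p, fun m hm => ?_⟩⟩
  obtain ⟨i, hi, hcnt⟩ := hC m hm
  obtain ⟨S, hSc, hS⟩ := cnt_set (q := q) (f := f) m i
  have hqi : 0 < q ^ i := by positivity
  have hqt : 0 < q ^ p := by positivity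
  have hiC : q ^ i ≤ q ^ C := Nat.pow_le_pow_right (by omega) hi
  have hpt : p < q ^ p := Nat.lt_pow_self (by omega)
  have hbad : (S.filter (fun N => p ∣ N)).card ≤ 1 := by
    rw [Finset.card_le_one]
    intro a ha b hb
    obtain ⟨ha1, ha2⟩ := Finset.mem_filter.1 ha
    obtain ⟨hb1, hb2⟩ := Finset.mem_filter.1 hb
    obtain ⟨_, r, hr, rfl⟩ := hS a ha1
    obtain ⟨_, s, hs, rfl⟩ := hS b hb1
    have h : q ^ i * m + r ≡ q ^ i * m + s [MOD p] :=
      (Nat.modEq_zero_iff_dvd.2 ha2).trans (Nat.modEq_zero_iff_dvd.2 hb2).symm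
    have h2 := Nat.ModEq.add_left_cancel' _ h
    rw [Nat.ModEq.eq_of_lt_of_lt h2 (by omega) (by omega)]
  set S' := (S.filter (fun N => ¬ p ∣ N)).image (fun N => p * N) with hS'
  have hS'c : 2 * B0 ≤ S'.card := by
    rw [hS', Finset.card_image_of_injective _ (mul_right_injective₀ hp.ne_zero)]
    have := Finset.card_filter_add_card_filter_not (s := S) (fun N => p ∣ N)
    omega
  set b0 := p * m / q ^ p with hb0
  have h1 : q ^ p * b0 + p * m % q ^ p = p * m := Nat.div_add_mod (p * m) (q ^ p)
  have h2 := Nat.mod_lt (p * m) hqt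
  have h3 := Nat.zero_le (p * m % q ^ p)
  obtain ⟨b, hb, hr⟩ := pigeon hq hB0 S' {b0, b0 + 1} (p + i) (by
      intro N hN
      obtain ⟨N', hN', rfl⟩ := Finset.mem_image.1 hN
      obtain ⟨hN1, hN2⟩ := Finset.mem_filter.1 hN'
      obtain ⟨hf, r, hr, rfl⟩ := hS N' hN1
      refine ⟨?_, ?_⟩
      · rw [hmul _ _ ((hp.coprime_iff_not_dvd).2 hN2)]
        exact mul_ne_zero hfp hf
      · have hlo : b0 ≤ p * (q ^ i * m + r) / q ^ (p + i) := by
          rw [Nat.le_div_iff_mul_le (by positivity)]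
          calc b0 * q ^ (p + i) = q ^ i * (q ^ p * b0) := by ring
            _ ≤ q ^ i * (p * m) := Nat.mul_le_mul_left _ (by omega)
            _ ≤ p * (q ^ i * m + r) := by nlinarith [Nat.zero_le (p * r)]
        have hhi : p * (q ^ i * m + r) / q ^ (p + i) < b0 + 2 := by
          rw [Nat.div_lt_iff_lt_mul (by positivity)]
          calc p * (q ^ i * m + r) < p * (q ^ i * m + q ^ i) :=
                Nat.mul_lt_mul_of_pos_left (by omega) hp.pos
            _ = q ^ i * (p * m + p) := by ring
            _ ≤ q ^ i * (q ^ p * b0 + q ^ p + q ^ p) := Nat.mul_le_mul_left _ (by omega)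
            _ = (b0 + 2) * q ^ (p + i) := by ring
        simp only [Finset.mem_insert, Finset.mem_singleton]
        omega) (by simp) (by
      refine le_trans (Nat.mul_le_mul_right _ Finset.card_le_two) hS'c)
  refine ⟨b, hr, ?_⟩
  simp only [Finset.mem_insert, Finset.mem_singleton] at hb
  generalize p * m % q ^ p = y at h1 h2 h3
  rcases hb with rfl | rfl
  · constructor <;> omega
  · rw [mul_add]; constructor <;> omega

end partA

section partA2
variable {q : ℕ} {f : ℕ → ℂ}

theorem pump_data (hq : 2 ≤ q) [Finite (Quotient (sd q f))]
    (hinf : {p : ℕ | p.Prime ∧ f p ≠ 0}.Infinite) :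
    ∃ i d n e r, 0 < d ∧ 0 < n ∧ r < q ^ i ∧ e < q ^ d ∧ Eqv q f n (q ^ d * n + e) ∧
      f (q ^ i * n + r) ≠ 0 := by
  classical
  have : Fintype (Quotient (sd q f)) := Fintype.ofFinite _
  set s := Fintype.card (Quotient (sd q f)) with hs
  obtain ⟨p, ⟨hp, hfp⟩, hpV⟩ := hinf.exists_gt (q ^ (s + 1))
  obtain ⟨i, j, hij, he⟩ : ∃ i j : Fin (s + 1), i < j ∧
      Quotient.mk (sd q f) (p / q ^ (i : ℕ)) = Quotient.mk (sd q f) (p / q ^ (j : ℕ)) := by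
    obtain ⟨i, j, hij, he⟩ := Fintype.exists_ne_map_eq_of_card_lt
      (fun i : Fin (s + 1) => Quotient.mk (sd q f) (p / q ^ (i : ℕ))) (by simp [hs])
    rcases lt_or_gt_of_ne hij with h | h
    · exact ⟨i, j, h, he⟩
    · exact ⟨j, i, h, he.symm⟩
  have heq := mk_eq_iff.1 he
  have hlt : (i : ℕ) < j := hij
  have hj : (j : ℕ) < s + 1 := j.2
  generalize (i : ℕ) = i at *
  generalize (j : ℕ) = j at *
  obtain ⟨d, rfl⟩ := Nat.exists_eq_add_of_lt hlt
  have hqi : 0 < q ^ i := by positivity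
  have hdm : p / q ^ i = q ^ (d + 1) * (p / q ^ (i + d + 1)) + (p / q ^ i) % q ^ (d + 1) := by
    conv_lhs => rw [← Nat.div_add_mod (p / q ^ i) (q ^ (d + 1)), Nat.div_div_eq_div_mul,
      ← pow_add, ← add_assoc]
  refine ⟨i, d + 1, p / q ^ (i + d + 1), (p / q ^ i) % q ^ (d + 1), p % q ^ i, by omega, ?_,
    Nat.mod_lt _ hqi, Nat.mod_lt _ (by positivity), ?_, ?_⟩
  · apply Nat.div_pos _ (by positivity)
    exact (Nat.pow_le_pow_right (by omega) (by omega)).trans hpV.le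
  · rw [← hdm]; exact heq.symm
  · rw [← heq i _ (Nat.mod_lt _ hqi), Nat.div_add_mod]; exact hfp

theorem pump {n e d : ℕ} (h : Eqv q f n (q ^ d * n + e)) (he : e < q ^ d) {D1 : ℕ}
    (hD : q ^ d = D1 + 1) : ∃ x : ℕ → ℕ, ∀ k, Eqv q f n (x k) ∧ (q ^ d) ^ k * n ≤ x k ∧
      x k < (q ^ d) ^ k * (n + 1) ∧ D1 * x k + e = (q ^ d) ^ k * (D1 * n + e) := by
  refine ⟨fun k => Nat.rec n (fun _ y => q ^ d * y + e) k, fun k => ?_⟩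
  induction k with
  | zero => simp [Eqv.refl]
  | succ k ih =>
    simp only at ih ⊢
    generalize (Nat.rec n (fun _ y => q ^ d * y + e) k : ℕ) = y at ih ⊢
    obtain ⟨h1, h2, h3, h4⟩ := ih
    refine ⟨h.trans (h1.app he), ?_, ?_, ?_⟩
    · calc (q ^ d) ^ (k + 1) * n = q ^ d * ((q ^ d) ^ k * n) := by ring
        _ ≤ q ^ d * y := Nat.mul_le_mul_left _ h2
        _ ≤ _ := by omega
    · calc q ^ d * y + e < q ^ d * y + q ^ d := by omega
        _ = q ^ d * (y + 1) := by ring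
        _ ≤ q ^ d * ((q ^ d) ^ k * (n + 1)) := Nat.mul_le_mul_left _ h3
        _ = _ := by ring
    · rw [pow_succ, mul_comm _ (q ^ d), mul_assoc, ← h4, hD]; ring

theorem pump_seq (hq : 2 ≤ q) [Finite (Quotient (sd q f))]
    (hinf : {p : ℕ | p.Prime ∧ f p ≠ 0}.Infinite) :
    ∃ (N : ℕ → ℕ) (A A' d : ℕ), 0 < A ∧ 0 < d ∧
      (∀ k, f (N k) ≠ 0 ∧ A * (q ^ d) ^ k ≤ N k ∧ N k < A' * (q ^ d) ^ k) ∧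
      ∀ S, ∃ P, ∀ p, p.Prime → P < p → ∀ k s, 0 < s → s ≤ S → p ∣ N k → ¬ p ∣ N (k + s) := by
  obtain ⟨i, d, n, e, r, hd, hn, hr, he, hE, hf⟩ := pump_data hq hinf
  have hD2 : 2 ≤ q ^ d := hq.trans (Nat.le_self_pow hd.ne' q)
  obtain ⟨D1, hD⟩ : ∃ D1, q ^ d = D1 + 1 := ⟨q ^ d - 1, by omega⟩
  obtain ⟨x, hx⟩ := pump hE he hD
  have hqi : 0 < q ^ i := by positivity
  refine ⟨fun k => q ^ i * x k + r, q ^ i * n, q ^ i * (n + 1), d, by positivity, hd, ?_, ?_⟩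
  · intro k
    obtain ⟨h1, h2, h3, h4⟩ := hx k
    refine ⟨?_, ?_, ?_⟩
    · rw [← h1 i r hr]; exact hf
    · calc q ^ i * n * (q ^ d) ^ k = q ^ i * ((q ^ d) ^ k * n) := by ring
        _ ≤ q ^ i * x k := Nat.mul_le_mul_left _ h2
        _ ≤ _ := Nat.le_add_right _ _
    · calc q ^ i * x k + r < q ^ i * x k + q ^ i := by omega
        _ = q ^ i * (x k + 1) := by ring
        _ ≤ q ^ i * ((q ^ d) ^ k * (n + 1)) := Nat.mul_le_mul_left _ h3
        _ = _ := by ring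
  · intro S
    refine ⟨q + (q ^ d) ^ S + (D1 * n + e), fun p hp hP k s hs hsS h1 h2 => ?_⟩
    have hpq : Nat.Coprime p q := by
      rw [hp.coprime_iff_not_dvd]
      exact fun h => absurd (Nat.le_of_dvd (by omega) h) (by omega)
    have hc0 : 0 < D1 * n + e := by
      have : 0 < D1 * n := Nat.mul_pos (by omega) hn
      omega
    have hpc : Nat.Coprime p (D1 * n + e) := by
      rw [hp.coprime_iff_not_dvd]
      exact fun h => absurd (Nat.le_of_dvd hc0 h) (by omega)
    have h3 : q ^ i * x (k + s) + r ≡ q ^ i * x k + r [MOD p] :=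
      (Nat.modEq_zero_iff_dvd.2 h2).trans (Nat.modEq_zero_iff_dvd.2 h1).symm
    have h4 := Nat.ModEq.add_right_cancel' _ h3
    have h5 : x (k + s) ≡ x k [MOD p] := Nat.ModEq.cancel_left_of_coprime
      (hpq.pow_right i) h4
    have h6 := (h5.mul_left D1).add_right e
    rw [(hx (k + s)).2.2.2, (hx k).2.2.2] at h6
    have h7 := Nat.ModEq.cancel_right_of_coprime hpc h6
    rw [pow_add] at h7
    have h8 : (q ^ d) ^ s ≡ 1 [MOD p] := Nat.ModEq.cancel_left_of_coprime
      ((hpq.pow_right d).pow_right k) (by simpa using h7)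
    have h9 : (q ^ d) ^ s ≤ (q ^ d) ^ S := Nat.pow_le_pow_right (by omega) hsS
    have h10 := Nat.ModEq.eq_of_lt_of_lt h8 (by omega) hp.one_lt
    have h11 : q ^ d ≤ (q ^ d) ^ s := Nat.le_self_pow hs.ne' _
    omega

theorem exists_rich (hq : 2 ≤ q) [Finite (Quotient (sd q f))]
    (hmul : ∀ m n : ℕ, Nat.Coprime m n → f (m * n) = f m * f n)
    (hinf : {p : ℕ | p.Prime ∧ f p ≠ 0}.Infinite) : ∃ m, 0 < m ∧ Rich q f m := by
  classical
  obtain ⟨B0, hB0⟩ := rich_thresh (q := q) (f := f)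
  obtain ⟨N, A, A', d, hA, hd, hN, hdiv⟩ := pump_seq hq hinf
  have hD2 : 2 ≤ q ^ d := hq.trans (Nat.le_self_pow hd.ne' q)
  set D := q ^ d with hD
  set W := Finset.Ico A (A' * D) with hW
  set B := W.card * B0 with hB
  obtain ⟨P, hP⟩ := hdiv (B * B)
  obtain ⟨F, hF, hFc⟩ := (hinf.sdiff (Set.finite_Iic P)).exists_subset_card_eq B
  have hF' : ∀ p ∈ F, p.Prime ∧ f p ≠ 0 ∧ P < p := by
    intro p hp
    have := hF hp
    exact ⟨this.1.1, this.1.2, not_le.1 this.2⟩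
  set L := F.sup (fun p => Nat.log D p) with hL
  have hlL : ∀ p ∈ F, Nat.log D p ≤ L := fun p hp => Finset.le_sup (f := fun p => Nat.log D p) hp
  obtain ⟨t, ht⟩ : ∃ t, ∀ p ∈ F, ∀ p' ∈ F, ¬ p ∣ N (L - Nat.log D p' + t) := by
    by_contra! hcon
    have hsub : Finset.range (B * B + 1) ⊆ (F ×ˢ F).biUnion (fun z =>
        (Finset.range (B * B + 1)).filter (fun t => z.1 ∣ N (L - Nat.log D z.2 + t))) := by
      intro t ht
      obtain ⟨p, hp, p', hp', h⟩ := hcon t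
      exact Finset.mem_biUnion.2 ⟨(p, p'), Finset.mem_product.2 ⟨hp, hp'⟩,
        Finset.mem_filter.2 ⟨ht, h⟩⟩
    have h1 := Finset.card_le_card hsub
    have h2 := h1.trans (Finset.card_biUnion_le_card_mul _ _ 1 (by
      rintro ⟨p, p'⟩ hz
      obtain ⟨hp, hp'⟩ := Finset.mem_product.1 hz
      have key : ∀ a b, a < b → b ∈ Finset.range (B * B + 1) →
          p ∣ N (L - Nat.log D p' + a) → ¬ p ∣ N (L - Nat.log D p' + b) := by
        intro a b hab hb h
        have hb' := Finset.mem_range.1 hb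
        have := hP p (hF' p hp).1 (hF' p hp).2.2 _ (b - a) (by omega) (by omega) h
        rwa [add_assoc, Nat.add_sub_cancel' hab.le] at this
      rw [Finset.card_le_one]
      intro a ha b hb
      obtain ⟨ha1, ha2⟩ := Finset.mem_filter.1 ha
      obtain ⟨hb1, hb2⟩ := Finset.mem_filter.1 hb
      rcases lt_trichotomy a b with h | h | h
      · exact absurd hb2 (key a b h hb1 ha2)
      · exact h
      · exact absurd ha2 (key b a h ha1 hb2)))
    rw [Finset.card_range, Finset.card_product, hFc] at h2
    omega
  obtain ⟨b, hb, hr⟩ := pigeon hq hB0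
    (F.image fun p => p * N (L - Nat.log D p + t)) W (d * (L + t)) (by
      intro M hM
      obtain ⟨p, hp, rfl⟩ := Finset.mem_image.1 hM
      obtain ⟨hpp, hfp, hpP⟩ := hF' p hp
      obtain ⟨h1, h2, h3⟩ := hN (L - Nat.log D p + t)
      have h4 : D ^ Nat.log D p ≤ p := Nat.pow_log_le_self D hpp.ne_zero
      have h5 : p < D ^ (Nat.log D p + 1) := Nat.lt_pow_succ_log_self (by omega) p
      have h6 := hlL p hp
      refine ⟨?_, ?_⟩
      · rw [hmul _ _ ((hpp.coprime_iff_not_dvd).2 (ht p hp p hp))]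
        exact mul_ne_zero hfp h1
      · rw [pow_mul, ← hD, hW, Finset.mem_Ico, Nat.le_div_iff_mul_le (by positivity),
          Nat.div_lt_iff_lt_mul (by positivity)]
        have h7 : L + t = Nat.log D p + (L - Nat.log D p + t) := by omega
        constructor
        · calc A * D ^ (L + t) = D ^ Nat.log D p * (A * D ^ (L - Nat.log D p + t)) := by
                rw [h7, pow_add]; ring_nf
            _ ≤ _ := Nat.mul_le_mul h4 h2
        · calc _ < D ^ (Nat.log D p + 1) * (A' * D ^ (L - Nat.log D p + t)) :=
                Nat.mul_lt_mul'' h5 h3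
            _ = _ := by
                rw [h7, pow_add, pow_succ]; ring_nf) (by
      rw [hW, Finset.nonempty_Ico]
      have := hN 0
      simp only [pow_zero, mul_one] at this
      nlinarith) (by
      rw [Finset.card_image_of_injOn]
      · rw [hFc]
      · intro p hp p' hp' h
        simp only at h
        by_contra hne
        have h1 : p ∣ p' * N (L - Nat.log D p' + t) := ⟨_, h.symm⟩
        rcases ((hF' p hp).1.dvd_mul).1 h1 with h2 | h2
        · exact hne ((Nat.prime_dvd_prime_iff_eq (hF' p hp).1 (hF' p' hp').1).1 h2)
        · exact ht p hp p' hp' h2)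
  rw [hW, Finset.mem_Ico] at hb
  exact ⟨b, by omega, hr⟩

end partA2

section partA3
variable {q : ℕ} {f : ℕ → ℂ}

/-- Scaled limits of rich integers. -/
def Y (q : ℕ) (f : ℕ → ℂ) (x : ℝ) : Prop :=
  ∀ ε : ℝ, 0 < ε → ∀ M : ℕ, ∃ m, M ≤ m ∧ Rich q f m ∧ ∃ k : ℤ, |(m : ℝ) / (q : ℝ) ^ k - x| < ε

theorem Y_zpow (hq : 2 ≤ q) {x : ℝ} (h : Y q f x) (c : ℤ) : Y q f (x * (q : ℝ) ^ c) := by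
  intro ε hε M
  have hq0 : (0 : ℝ) < q := by exact_mod_cast (by omega : 0 < q)
  have hc : (0 : ℝ) < (q : ℝ) ^ c := by positivity
  obtain ⟨m, hm, hr, k, hk⟩ := h (ε / (q : ℝ) ^ c) (by positivity) M
  refine ⟨m, hm, hr, k - c, ?_⟩
  have : (m : ℝ) / (q : ℝ) ^ (k - c) - x * (q : ℝ) ^ c = (m / (q : ℝ) ^ k - x) * (q : ℝ) ^ c := by
    rw [zpow_sub₀ hq0.ne']; field_simp
  rw [this, abs_mul, abs_of_pos hc]
  exact (lt_div_iff₀ hc).1 hk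

theorem Y_mul (hq : 2 ≤ q) {p t : ℕ} (hp : 0 < p)
    (hpt : ∀ m, Rich q f m → ∃ b, Rich q f b ∧ q ^ t * b ≤ p * m + q ^ t ∧
      p * m < q ^ t * b + q ^ t) {x : ℝ} (hx : 0 < x) (h : Y q f x) : Y q f (p * x) := by
  intro ε hε M
  have hq0 : (0 : ℝ) < q := by exact_mod_cast (by omega : 0 < q)
  have hp0 : (0 : ℝ) < p := by exact_mod_cast hp
  have hqt : (0 : ℝ) < (q : ℝ) ^ t := by positivity
  obtain ⟨M1, hM1⟩ := exists_nat_gt ((q : ℝ) ^ t * (x + 1) * 2 / ε)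
  obtain ⟨m, hm, hr, k, hk⟩ := h (min 1 (ε / (2 * p))) (by positivity) (M1 + q ^ t * (M + 1))
  obtain ⟨b, hb, h1, h2⟩ := hpt m hr
  have hqtN : 0 < q ^ t := by positivity
  have hkk : (0 : ℝ) < (q : ℝ) ^ k := by positivity
  have hk1 := lt_of_lt_of_le hk (min_le_left _ _)
  have hk2 := lt_of_lt_of_le hk (min_le_right _ _)
  refine ⟨b, ?_, hb, k - t, ?_⟩
  · by_contra hlt
    have h3 : q ^ t * b + q ^ t ≤ q ^ t * (M + 1) := by
      calc q ^ t * b + q ^ t = q ^ t * (b + 1) := by ring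
        _ ≤ _ := Nat.mul_le_mul_left _ (by omega)
    have h4 : m ≤ p * m := Nat.le_mul_of_pos_left _ hp
    omega
  · have hmM : (M1 : ℝ) ≤ m := by exact_mod_cast (by omega : M1 ≤ m)
    have e1 : (b : ℝ) / (q : ℝ) ^ (k - t) - p * x =
        ((q : ℝ) ^ t * b - p * m) / (q : ℝ) ^ k + p * (m / (q : ℝ) ^ k - x) := by
      rw [zpow_sub₀ hq0.ne', zpow_natCast]; field_simp; ring
    have h1' : (q : ℝ) ^ t * b ≤ p * m + (q : ℝ) ^ t := by exact_mod_cast h1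
    have h2' : (p : ℝ) * m < (q : ℝ) ^ t * b + (q : ℝ) ^ t := by exact_mod_cast h2
    have e2 : |((q : ℝ) ^ t * b - p * m) / (q : ℝ) ^ k| < ε / 2 := by
      rw [abs_div, abs_of_pos hkk, div_lt_iff₀ hkk]
      have e3 : |(q : ℝ) ^ t * b - p * m| ≤ (q : ℝ) ^ t := by
        rw [abs_le]; constructor <;> linarith
      refine lt_of_le_of_lt e3 ?_
      have e4 : (m : ℝ) / (q : ℝ) ^ k < x + 1 := by linarith [(abs_lt.1 hk1).2]
      rw [div_lt_iff₀ hkk] at e4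
      have e5 : (q : ℝ) ^ t * (x + 1) * 2 < m * ε := by
        rw [div_lt_iff₀ hε] at hM1
        nlinarith
      have e6 : (q : ℝ) ^ t * (x + 1) * 2 < (x + 1) * (q : ℝ) ^ k * ε := by nlinarith
      have e7 : (x + 1) * ((q : ℝ) ^ t * 2) < (x + 1) * ((q : ℝ) ^ k * ε) := by linarith
      have e8 := lt_of_mul_lt_mul_left e7 (by linarith)
      linarith
    have e9 : |(p : ℝ) * (m / (q : ℝ) ^ k - x)| < ε / 2 := by
      rw [abs_mul, abs_of_pos hp0]
      have : (p : ℝ) * |(m / (q : ℝ) ^ k - x)| < p * (ε / (2 * p)) :=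
        mul_lt_mul_of_pos_left hk2 hp0
      have e10 : (p : ℝ) * (ε / (2 * p)) = ε / 2 := by field_simp
      linarith
    rw [e1]
    exact (abs_add_le _ _).trans_lt (by linarith)

theorem Y_exists (hq : 2 ≤ q) [Finite (Quotient (sd q f))] {m0 : ℕ} (hm0 : 0 < m0)
    (hr : Rich q f m0) : ∃ x : ℝ, 0 < x ∧ Y q f x := by
  have hstep : ∀ z : {m // Rich q f m}, ∃ w : {m // Rich q f m}, ∃ d < q, w.1 = q * z.1 + d := by
    rintro ⟨m, hm⟩
    obtain ⟨d, hd, h⟩ := rich_child hq hm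
    exact ⟨⟨_, h⟩, d, hd, rfl⟩
  choose g hg using hstep
  let z : ℕ → {m // Rich q f m} := fun k => Nat.rec ⟨m0, hr⟩ (fun _ y => g y) k
  have hz : ∀ k, ∃ d < q, (z (k + 1)).1 = q * (z k).1 + d := fun k => hg (z k)
  have hz0 : (z 0).1 = m0 := rfl
  have hq0 : (0 : ℝ) < q := by exact_mod_cast (by omega : 0 < q)
  let u : ℕ → ℝ := fun k => ((z k).1 : ℝ) / (q : ℝ) ^ k
  have hmono : Monotone u := by
    apply monotone_nat_of_le_succ
    intro k
    obtain ⟨d, hd, h⟩ := hz k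
    simp only [u]
    rw [h, div_le_div_iff₀ (by positivity) (by positivity)]
    push_cast
    have : (0 : ℝ) ≤ d * (q : ℝ) ^ k := by positivity
    rw [pow_succ]; nlinarith
  have hub : ∀ k, (z k).1 + 1 ≤ q ^ k * (m0 + 1) := by
    intro k
    induction k with
    | zero => simp [hz0]
    | succ k ih =>
      obtain ⟨d, hd, h⟩ := hz k
      rw [h]
      calc q * (z k).1 + d + 1 ≤ q * ((z k).1 + 1) := by rw [mul_add]; omega
        _ ≤ q * (q ^ k * (m0 + 1)) := Nat.mul_le_mul_left _ ih
        _ = _ := by ring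
  have hbdd : BddAbove (Set.range u) := by
    refine ⟨m0 + 1, ?_⟩
    rintro _ ⟨k, rfl⟩
    simp only [u]
    rw [div_le_iff₀ (by positivity)]
    have : ((z k).1 : ℝ) + 1 ≤ (q : ℝ) ^ k * (m0 + 1) := by exact_mod_cast hub k
    linarith
  have hpos : ∀ k, 0 < (z k).1 := by
    intro k
    induction k with
    | zero => rw [hz0]; exact hm0
    | succ k ih =>
      obtain ⟨d, hd, h⟩ := hz k
      rw [h]; positivity
  have hlb : ∀ k, k ≤ (z k).1 := by
    intro k
    induction k with
    | zero => exact Nat.zero_le _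
    | succ k ih =>
      obtain ⟨d, hd, h⟩ := hz k
      have := hpos k
      rw [h]
      nlinarith
  have hlim := tendsto_atTop_ciSup hmono hbdd
  refine ⟨⨆ k, u k, ?_, ?_⟩
  · have h1 : u 0 ≤ ⨆ k, u k := le_ciSup hbdd 0
    have h2 : u 0 = m0 := by simp [u, hz0]
    have h3 : (0 : ℝ) < m0 := by exact_mod_cast hm0
    linarith
  · intro ε hε M
    obtain ⟨K, hK⟩ := Metric.tendsto_atTop.1 hlim ε hε
    refine ⟨(z (max K M)).1, (le_max_right _ _).trans (hlb _), (z _).2, (max K M : ℕ), ?_⟩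
    have := hK (max K M) (le_max_left _ _)
    rw [Real.dist_eq] at this
    rw [zpow_natCast]
    exact this

theorem partA (hq : 2 ≤ q) [Finite (Quotient (sd q f))]
    (hmul : ∀ m n : ℕ, Nat.Coprime m n → f (m * n) = f m * f n)
    (hinf : {p : ℕ | p.Prime ∧ f p ≠ 0}.Infinite)
    (hinf0 : {p : ℕ | p.Prime ∧ ∃ e, f (p ^ e) = 0}.Infinite) : False := by
  obtain ⟨y, hy, hdead⟩ := dead hq hmul hinf0
  obtain ⟨m0, hm0, hr0⟩ := exists_rich hq hmul hinf
  obtain ⟨x0, hx0, hY0⟩ := Y_exists hq hm0 hr0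
  obtain ⟨R, hR⟩ := rich_mul (f := f) hq hmul
  obtain ⟨p, ⟨hp, hfp⟩, hpR⟩ := hinf.exists_gt (R + q)
  obtain ⟨t, ht⟩ := hR p hp (by omega) hfp
  have hq0 : (0 : ℝ) < q := by exact_mod_cast (by omega : 0 < q)
  have hp0 : (0 : ℝ) < p := by exact_mod_cast hp.pos
  have hy0 : (0 : ℝ) < y := by exact_mod_cast hy
  have hYp : ∀ j : ℕ, Y q f ((p : ℝ) ^ j * x0) := by
    intro j
    induction j with
    | zero => simpa using hY0
    | succ j ih =>
      have := Y_mul hq hp.pos ht (by positivity) ih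
      rwa [← mul_assoc, ← pow_succ'] at this
  obtain ⟨j, k, h1, h2⟩ := dense_aux hq hp (by omega : q < p)
    (a := Real.log y - Real.log x0) (b := Real.log (y + 1) - Real.log x0)
    (by linarith [Real.log_lt_log hy0 (by linarith : (y : ℝ) < y + 1)])
  set x := (p : ℝ) ^ j * x0 * (q : ℝ) ^ k with hx
  have hxpos : 0 < x := by positivity
  have hlog : Real.log x = j * Real.log p + k * Real.log q + Real.log x0 := by
    rw [hx, Real.log_mul (by positivity) (by positivity), Real.log_mul (by positivity) hx0.ne',
      Real.log_pow, Real.log_zpow]; ring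
  have hxl : (y : ℝ) < x := (Real.log_lt_log_iff hy0 hxpos).1 (by linarith)
  have hxu : x < y + 1 := (Real.log_lt_log_iff hxpos (by linarith)).1 (by linarith)
  have hYx : Y q f x := Y_zpow hq (hYp j) k
  obtain ⟨m, hm, hr, c, hc⟩ := hYx (min (x - y) (y + 1 - x))
    (lt_min (by linarith) (by linarith)) (y + 1)
  have hc1 := (abs_lt.1 (lt_of_lt_of_le hc (min_le_left _ _))).1
  have hc2 := (abs_lt.1 (lt_of_lt_of_le hc (min_le_right _ _))).2
  have hmy : (y : ℝ) + 1 ≤ m := by exact_mod_cast hm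
  have hcpos : (0 : ℝ) < (q : ℝ) ^ c := by positivity
  have hml : (y : ℝ) * (q : ℝ) ^ c < m := (lt_div_iff₀ hcpos).1 (by linarith)
  have hmu : (m : ℝ) < (y + 1) * (q : ℝ) ^ c := (div_lt_iff₀ hcpos).1 (by linarith)
  have hc0 : 0 ≤ c := by
    by_contra hneg
    have : (q : ℝ) ^ c ≤ 1 := zpow_le_one_of_nonpos₀ (by exact_mod_cast (by omega : 1 ≤ q)) (by omega)
    nlinarith
  obtain ⟨κ, rfl⟩ := Int.eq_ofNat_of_zero_le hc0
  rw [zpow_natCast] at hml hmu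
  have hml' : y * q ^ κ < m := by exact_mod_cast hml
  have hmu' : m < (y + 1) * q ^ κ := by exact_mod_cast hmu
  obtain ⟨r, hr'⟩ := Nat.exists_eq_add_of_le hml'.le
  have hrlt : r < q ^ κ := by rw [add_mul] at hmu'; omega
  obtain ⟨i, hi⟩ := hr 1
  obtain ⟨S, hSc, hS⟩ := cnt_set (q := q) (f := f) m i
  obtain ⟨N, hN⟩ := Finset.card_pos.1 (by omega : 0 < S.card)
  obtain ⟨hfN, s, hs, rfl⟩ := hS N hN
  apply hfN
  rw [hr', mul_comm y, word_app]
  exact hdead _ _ (word_lt hrlt hs)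

end partA3

theorem main_aux (q : ℕ) (hq : 2 ≤ q) (f : ℕ → ℂ)
    (hmul : ∀ m n : ℕ, Nat.Coprime m n → f (m * n) = f m * f n)
    (hauto : IsQAutomatic q f) :
    ∃ (Q : ℕ) (χ : DirichletCharacter ℂ Q), 1 ≤ Q ∧
      ((∀ n : ℕ, 0 < n → Nat.Coprime n Q → f n = χ (n : ZMod Q)) ∨
        ∃ N : ℕ, ∀ p : ℕ, p.Prime → N < p → f p = 0) := by
  classical
  have := fin_quot hq hauto
  by_cases hfin : {p : ℕ | p.Prime ∧ f p ≠ 0}.Finite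
  · obtain ⟨N, hN⟩ := hfin.bddAbove
    refine ⟨1, 1, le_rfl, Or.inr ⟨N, fun p hp hNp => ?_⟩⟩
    by_contra h
    exact absurd (hN ⟨hp, h⟩) (by omega)
  · have hinf : {p : ℕ | p.Prime ∧ f p ≠ 0}.Infinite := hfin
    have hfin0 : {p : ℕ | p.Prime ∧ ∃ e, f (p ^ e) = 0}.Finite := by
      by_contra h
      exact partA hq hmul hinf h
    obtain ⟨p1, hp1, hfp1⟩ := hinf.nonempty
    have hf1 : f 1 ≠ 0 := by
      intro h
      apply hfp1
      have := hmul p1 1 (by simp)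
      rwa [h, mul_zero, mul_one] at this
    have hP0 : 0 < ∏ p ∈ hfin0.toFinset, p :=
      Finset.prod_pos fun p hp => ((hfin0.mem_toFinset).1 hp).1.pos
    obtain ⟨Q, χ, hQ, hχ⟩ := partB hq hmul hP0 (by
      intro n
      induction n using Nat.recOnPosPrimePosCoprime with
      | prime_pow p e hp he =>
        intro _ hc hf
        have hmem : p ∈ hfin0.toFinset := hfin0.mem_toFinset.2 ⟨hp, e, hf⟩
        have hd : p ∣ ∏ p ∈ hfin0.toFinset, p := Finset.dvd_prod_of_mem (fun p => p) hmem
        have h1 := Nat.Coprime.eq_one_of_dvd ((Nat.coprime_pow_left_iff he _ _).1 hc) hd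
        exact hp.one_lt.ne' h1
      | zero => intro h; omega
      | one => intro _ _; exact hf1
      | coprime a b ha hb hab iha ihb =>
        intro _ hc
        rw [hmul _ _ hab]
        exact mul_ne_zero (iha (by omega) hc.coprime_mul_right) (ihb (by omega) hc.coprime_mul_left))
    exact ⟨Q, χ, hQ, Or.inl hχ⟩

end MA

theorem stmt_0 (q : ℕ) (hq : 2 ≤ q) (f : ℕ → ℂ)
    (hmul : ∀ m n : ℕ, Nat.Coprime m n → f (m * n) = f m * f n)
    (hauto : IsQAutomatic q f) :
    ∃ (Q : ℕ) (χ : DirichletCharacter ℂ Q), 1 ≤ Q ∧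
      ((∀ n : ℕ, 0 < n → Nat.Coprime n Q → f n = χ (n : ZMod Q)) ∨
        ∃ N : ℕ, ∀ p : ℕ, p.Prime → N < p → f p = 0) := by
  exact MA.main_aux q hq f hmul hauto
end

section
/- Let q ≥ 2 and let f : ℕ → {0,1} be a multiplicative q-automatic function such that the set of primes p with f(p) = 0 is infinite. Then there exists N such that f(p) = 0 for all primes p > N. -/
open Filter Topology

/-- Leading-digit density: powers of `B` hit any multiplicative window modulo powers of `q`. -/
lemma density_aux (q B c L R : ℝ) (hq : 1 < q) (hB : 1 < B) (hc : 0 < c) (hL : 0 < L)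
    (hLR : L < R) (hirr : Irrational (Real.log B / Real.log q)) (C : ℕ) :
    ∃ n : ℕ, C ≤ n ∧ ∃ m : ℤ, q ^ m * L < c * B ^ n ∧ c * B ^ n < q ^ m * R := by
  have hlq : 0 < Real.log q := Real.log_pos hq
  have : Fact (0 < Real.log q) := ⟨hlq⟩
  have hR : 0 < R := hL.trans hLR
  have hd := (AddCircle.denseRange_zsmul_coe_iff (p := Real.log q) (a := Real.log B)).2 hirr
  set U : Set (AddCircle (Real.log q)) :=
    (fun x : ℝ => (x : AddCircle (Real.log q))) ''
      Set.Ioo (Real.log L - Real.log c) (Real.log R - Real.log c) with hU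
  have hUo : IsOpen U := QuotientAddGroup.isOpenMap_coe _ isOpen_Ioo
  have hlt : Real.log L - Real.log c < Real.log R - Real.log c := by
    have := Real.log_lt_log hL hLR
    linarith
  obtain ⟨y, hy⟩ := exists_between hlt
  have hyU : (y : AddCircle (Real.log q)) ∈ U := ⟨y, hy, rfl⟩
  have hcl : MapClusterPt (y : AddCircle (Real.log q)) atTop
      (fun n : ℕ => n • (Real.log B : AddCircle (Real.log q))) := by
    rw [mapClusterPt_atTop_nsmul_iff_mem_topologicalClosure_zmultiples]
    exact hd y
  have hfr := hcl.frequently (hUo.mem_nhds hyU)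
  obtain ⟨n, hn, z, hz, hzn⟩ := (frequently_atTop.1 hfr) C
  refine ⟨n, hn, ?_⟩
  have h1 : ((n • Real.log B - z : ℝ) : AddCircle (Real.log q)) = 0 := by
    rw [AddCircle.coe_sub, AddCircle.coe_nsmul, sub_eq_zero]
    exact hzn.symm
  rw [AddCircle.coe_eq_zero_iff] at h1
  obtain ⟨m, hm⟩ := h1
  simp only [zsmul_eq_mul, nsmul_eq_mul] at hm
  have hq0 : 0 < q := by linarith
  have hB0 : 0 < B := by linarith
  have e1 : Real.log (c * B ^ n) = Real.log c + n * Real.log B := by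
    rw [Real.log_mul hc.ne' (by positivity), Real.log_pow]
  have e2 : ∀ X : ℝ, 0 < X → Real.log (q ^ m * X) = m * Real.log q + Real.log X := by
    intro X hX
    rw [Real.log_mul (by positivity) hX.ne', Real.log_zpow]
  refine ⟨m, ?_, ?_⟩
  · rw [← Real.log_lt_log_iff (by positivity) (by positivity), e1, e2 L hL]
    have := hz.1
    linarith
  · rw [← Real.log_lt_log_iff (by positivity) (by positivity), e1, e2 R hR]
    have := hz.2
    linarith

/-- If `f` vanishes at infinitely many primes, some leading word forces `f = 0`. -/
lemma zero_word (q : ℕ) (hq : 2 ≤ q) (f : ℕ → ℂ)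
    (hmul : ∀ m n : ℕ, Nat.Coprime m n → f (m * n) = f m * f n)
    (hauto : IsQAutomatic q f)
    (hinf : {p : ℕ | p.Prime ∧ f p = 0}.Infinite) :
    ∃ N : ℕ, ∀ m r : ℕ, 1 ≤ m → r < q ^ m → f (q ^ m * N + r) = 0 := by
  classical
  have hinf2 : ({p : ℕ | p.Prime ∧ f p = 0} \ (Set.Iic q)).Infinite :=
    hinf.sdiff (Set.finite_Iic q)
  let e := hinf2.natEmbedding
  let P : ℕ × ℕ → ℕ := fun x => (e (Nat.pair x.1 x.2) : ℕ)
  have hPp : ∀ x, (P x).Prime := fun x => (e (Nat.pair x.1 x.2)).2.1.1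
  have hPf : ∀ x, f (P x) = 0 := fun x => (e (Nat.pair x.1 x.2)).2.1.2
  have hPq : ∀ x, q < P x := fun x => by
    have := (e (Nat.pair x.1 x.2)).2.2
    simpa using this
  have hPinj : ∀ x y, P x = P y → x = y := by
    intro x y h
    have h1 := e.injective (Subtype.ext h)
    have h2 := Nat.pair_eq_pair.1 h1
    exact Prod.ext h2.1 h2.2
  have hrep : ∀ g : qKernel q f, ∃ x : ℕ × ℕ, g.1 = fun n => f (q ^ x.1 * n + x.2) := by
    rintro ⟨g, i, r, -, -, h⟩
    exact ⟨(i, r), h⟩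
  choose rep hrep using hrep
  letI : Fintype (qKernel q f) := hauto.fintype
  let F : Finset (ℕ × ℕ) := Finset.univ.image rep
  have hloc : ∀ x : ℕ × ℕ, ∃ a : ℕ, q ^ x.1 * a + x.2 ≡ P x [MOD (P x) ^ 2] := by
    intro x
    have hcop : Nat.Coprime (q ^ x.1) ((P x) ^ 2) := by
      apply Nat.Coprime.pow
      exact (Nat.coprime_of_lt_prime (by omega) (hPq x) (hPp x)).symm
    have : NeZero ((P x) ^ 2) := ⟨pow_ne_zero _ (hPp x).ne_zero⟩
    refine ⟨(((q ^ x.1 : ℕ) : ZMod ((P x) ^ 2))⁻¹ * ((P x : ZMod ((P x)^2)) - x.2)).val, ?_⟩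
    rw [← ZMod.natCast_eq_natCast_iff]
    have h1 := ZMod.coe_mul_inv_eq_one (q ^ x.1) hcop
    rw [Nat.cast_add, Nat.cast_mul, ZMod.natCast_zmod_val, ← mul_assoc, h1]
    ring
  choose A hA using hloc
  obtain ⟨N, hN⟩ := Nat.chineseRemainderOfFinset A (fun x => (P x) ^ 2) F
    (fun x _ => pow_ne_zero _ (hPp x).ne_zero)
    (fun x _ y _ hxy => by
      apply Nat.Coprime.pow
      exact (Nat.coprime_primes (hPp x) (hPp y)).2 (fun h => hxy (hPinj x y h)))
  refine ⟨N, fun m r hm hr => ?_⟩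
  let g : qKernel q f := ⟨fun n => f (q ^ m * n + r), m, r, hm, by omega, rfl⟩
  have hg : f (q ^ m * N + r) = f (q ^ (rep g).1 * N + (rep g).2) := congrFun (hrep g) N
  rw [hg]
  set x := rep g with hx
  have hxF : x ∈ F := Finset.mem_image_of_mem _ (Finset.mem_univ g)
  have hc : q ^ x.1 * N + x.2 ≡ P x [MOD (P x) ^ 2] :=
    (((hN x hxF).mul_left _).add_right _).trans (hA x)
  set y := q ^ x.1 * N + x.2
  have hd1 : P x ∣ y := by
    have h2 : y ≡ P x [MOD P x] := hc.of_dvd (dvd_pow_self _ (by norm_num))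
    exact (h2.dvd_iff dvd_rfl).2 dvd_rfl
  have hd2 : ¬ (P x) ^ 2 ∣ y := by
    intro h
    have h3 := (hc.dvd_iff dvd_rfl).1 h
    have h4 := Nat.le_of_dvd (hPp x).pos h3
    have := (hPp x).two_le
    nlinarith
  obtain ⟨k, hk⟩ := hd1
  have hcop : Nat.Coprime (P x) k := by
    rw [(hPp x).coprime_iff_not_dvd]
    intro h
    apply hd2
    rw [hk, sq]
    exact mul_dvd_mul_left _ h
  rw [hk, hmul _ _ hcop, hPf, zero_mul]

/-- Products of distinct primes from an infinite set give `a ≡ 1` in the support. -/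
lemma exists_a (Q M D : ℕ) (hM : 0 < M) (hMQ : M ≤ Q) (hDQ : D ≤ Q) (hD : 0 < D) (f : ℕ → ℂ)
    (hf1 : f 1 = 1)
    (h01 : ∀ n : ℕ, f n = 0 ∨ f n = 1)
    (hmul : ∀ m n : ℕ, Nat.Coprime m n → f (m * n) = f m * f n)
    (hT : ∀ N : ℕ, ∃ p : ℕ, p.Prime ∧ N < p ∧ f p ≠ 0) :
    ∃ a : ℕ, 1 < a ∧ a ≡ 1 [MOD M] ∧ f a = 1 ∧ Nat.Coprime a D ∧ Nat.Coprime a M := by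
  classical
  have hinf : {p : ℕ | p.Prime ∧ Q < p ∧ f p = 1}.Infinite := by
    rw [Set.infinite_iff_exists_gt]
    intro N
    obtain ⟨p, hp, hN, hfp⟩ := hT (max N Q)
    exact ⟨p, ⟨hp, (le_max_right _ _).trans_lt hN, (h01 p).resolve_left hfp⟩,
      (le_max_left _ _).trans_lt hN⟩
  have : NeZero M := ⟨hM.ne'⟩
  have := hinf.to_subtype
  obtain ⟨c, hc⟩ := Finite.exists_infinite_fiber
    (fun p : {p : ℕ | p.Prime ∧ Q < p ∧ f p = 1} => ((p : ℕ) : ZMod M))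
  rw [Set.infinite_coe_iff] at hc
  have hc2 := hc.image (f := Subtype.val) Subtype.val_injective.injOn
  obtain ⟨s, hs, hcard⟩ := hc2.exists_subset_card_eq (Nat.totient M)
  have hsp : ∀ p ∈ s, p.Prime ∧ Q < p ∧ f p = 1 ∧ (p : ZMod M) = c := by
    intro p hp
    obtain ⟨⟨p', h1, h2, h3⟩, h4, rfl⟩ := hs hp
    exact ⟨h1, h2, h3, h4⟩
  have key : ∀ t ⊆ s, f (∏ p ∈ t, p) = 1 := by
    intro t
    induction t using Finset.induction_on with
    | empty => intro _; simpa using hf1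
    | insert p t hpt ih =>
      intro hts
      rw [Finset.prod_insert hpt, hmul, ih (fun x hx => hts (Finset.mem_insert_of_mem hx)),
        (hsp p (hts (Finset.mem_insert_self _ _))).2.2.1, one_mul]
      apply Nat.Coprime.prod_right
      intro r hr
      refine (Nat.coprime_primes (hsp p (hts (Finset.mem_insert_self _ _))).1
        (hsp r (hts (Finset.mem_insert_of_mem hr))).1).2 ?_
      rintro rfl
      exact hpt hr
  have hcop : ∀ E : ℕ, 0 < E → E ≤ Q → Nat.Coprime (∏ p ∈ s, p) E := by
    intro E hE hEQ
    apply Nat.Coprime.prod_left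
    intro p hp
    obtain ⟨h1, h2, -, -⟩ := hsp p hp
    exact Nat.coprime_of_lt_prime (by omega) (by omega) h1
  have hne : s.Nonempty := by
    rw [← Finset.card_pos, hcard]
    exact Nat.totient_pos.2 hM
  obtain ⟨p0, hp0⟩ := hne
  refine ⟨∏ p ∈ s, p, ?_, ?_, key s subset_rfl, hcop D hD hDQ, hcop M hM hMQ⟩
  · have h1 : p0 ∣ ∏ p ∈ s, p := Finset.dvd_prod_of_mem _ hp0
    have h2 : 0 < ∏ p ∈ s, p := Finset.prod_pos (fun p hp => (hsp p hp).1.pos)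
    exact (hsp p0 hp0).1.one_lt.trans_le (Nat.le_of_dvd h2 h1)
  · have h3 : (∏ p ∈ s, p) ≡ p0 ^ Nat.totient M [MOD M] := by
      rw [← ZMod.natCast_eq_natCast_iff]
      push_cast
      rw [Finset.prod_congr rfl (fun p hp => (hsp p hp).2.2.2), Finset.prod_const, hcard,
        (hsp p0 hp0).2.2.2]
    refine h3.trans (Nat.ModEq.pow_totient ?_)
    obtain ⟨h1, h2, -, -⟩ := hsp p0 hp0
    exact Nat.coprime_of_lt_prime (by omega) (by omega) h1

lemma irr_aux (q d a : ℕ) (hq : 2 ≤ q) (ha : 1 < a) (hcop : Nat.Coprime a q) :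
    Irrational (Real.log ((q : ℝ) ^ d * a) / Real.log q) := by
  have hq1 : (1 : ℝ) < q := by exact_mod_cast (by omega : 1 < q)
  have ha1 : (1 : ℝ) < a := by exact_mod_cast ha
  have hlq : 0 < Real.log q := Real.log_pos hq1
  have hB : 1 < (q : ℝ) ^ d * a := one_lt_mul_of_le_of_lt (one_le_pow₀ hq1.le) ha1
  have hlB := Real.log_pos hB
  rintro ⟨r, hr⟩
  have hrpos : 0 < r := by
    have : (0 : ℝ) < r := by rw [hr]; positivity
    exact_mod_cast this
  have hnum : ((r.num.toNat : ℤ)) = r.num := Int.toNat_of_nonneg (Rat.num_nonneg.2 hrpos.le)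
  have hr2 : (r : ℝ) = (r.num.toNat : ℝ) / r.den := by
    have h1 : ((r.num.toNat : ℝ)) = (r.num : ℝ) := by exact_mod_cast hnum
    rw [h1]
    exact Rat.cast_def r
  have hden : (0 : ℝ) < r.den := by exact_mod_cast r.den_pos
  rw [hr2, div_eq_div_iff hden.ne' hlq.ne'] at hr
  have h3 : Real.log ((q : ℝ) ^ r.num.toNat) = Real.log (((q : ℝ) ^ d * a) ^ r.den) := by
    rw [Real.log_pow, Real.log_pow, hr]
    ring
  have h4 : (q : ℝ) ^ r.num.toNat = ((q : ℝ) ^ d * a) ^ r.den :=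
    Real.log_injOn_pos (Set.mem_Ioi.2 (by positivity)) (Set.mem_Ioi.2 (by positivity)) h3
  have h5 : q ^ r.num.toNat = (q ^ d * a) ^ r.den := by exact_mod_cast h4
  have h6 : a ∣ q ^ r.num.toNat := by
    rw [h5]
    exact (dvd_mul_left a _).trans (dvd_pow_self _ r.den_pos.ne')
  have h7 := Nat.Coprime.eq_one_of_dvd (hcop.pow_right r.num.toNat) h6
  omega

theorem stmt_13 (q : ℕ) (hq : 2 ≤ q) (f : ℕ → ℂ)
    (h01 : ∀ n : ℕ, f n = 0 ∨ f n = 1)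
    (hmul : ∀ m n : ℕ, Nat.Coprime m n → f (m * n) = f m * f n)
    (hauto : IsQAutomatic q f)
    (hinf : {p : ℕ | p.Prime ∧ f p = 0}.Infinite) :
    ∃ N : ℕ, ∀ p : ℕ, p.Prime → N < p → f p = 0 := by
  by_contra hcon
  push Not at hcon
  have hf1 : f 1 = 1 := by
    obtain ⟨p, hp, -, hfp⟩ := hcon 0
    have h := hmul p 1 (by simp)
    rw [mul_one, (h01 p).resolve_left hfp] at h
    simpa using h.symm
  -- the zero word
  obtain ⟨N, hN⟩ := zero_word q hq f hmul hauto hinf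
  have hN0 : 0 < N := by
    rcases Nat.eq_zero_or_pos N with h | h
    · have := hN 1 1 le_rfl (by rw [pow_one]; omega)
      rw [h] at this
      simp [hf1] at this
    · exact h
  -- the repetition in the kernel
  obtain ⟨i, d, hi, hd, hrep⟩ : ∃ i d : ℕ, 1 ≤ i ∧ 1 ≤ d ∧
      ∀ n, f (q ^ (i + d) * n + 1) = f (q ^ i * n + 1) := by
    have hmaps : ∀ k : ℕ, (fun n => f (q ^ (k + 1) * n + 1)) ∈ qKernel q f := by
      intro k
      refine ⟨k + 1, 1, by omega, ?_, rfl⟩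
      have : 2 ^ 1 ≤ q ^ (k + 1) :=
        (Nat.pow_le_pow_left hq 1).trans (Nat.pow_le_pow_right (by omega) (by omega))
      omega
    have : Finite (qKernel q f) := hauto
    obtain ⟨x, y, hxy, h⟩ := Finite.exists_ne_map_eq_of_infinite
      (fun k : ℕ => (⟨_, hmaps k⟩ : qKernel q f))
    have h' : (fun n => f (q ^ (x + 1) * n + 1)) = fun n => f (q ^ (y + 1) * n + 1) :=
      congrArg Subtype.val h
    rcases lt_or_gt_of_ne hxy with hlt | hlt
    · refine ⟨x + 1, y - x, by omega, by omega, fun n => ?_⟩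
      rw [show x + 1 + (y - x) = y + 1 by omega]
      exact (congrFun h' n).symm
    · refine ⟨y + 1, x - y, by omega, by omega, fun n => ?_⟩
      rw [show y + 1 + (x - y) = x + 1 by omega]
      exact congrFun h' n
  have hqd : 2 ≤ q ^ d := by
    calc 2 ≤ q ^ 1 := by simpa using hq
      _ ≤ q ^ d := Nat.pow_le_pow_right (by omega) hd
  obtain ⟨a, ha1, hamod, hfa, haD, haM⟩ := exists_a (q ^ i + q ^ d) (q ^ i) (q ^ d - 1)
    (by positivity) (by omega) (by omega) (by omega) f hf1 h01 hmul hcon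
  have haq : Nat.Coprime a q := (Nat.coprime_pow_right_iff (by omega) a q).1 haM
  obtain ⟨α, hα⟩ : ∃ α, a = q ^ i * α + 1 := by
    have := (Nat.modEq_iff_dvd' ha1.le).1 hamod.symm
    obtain ⟨α, h⟩ := this
    exact ⟨α, by omega⟩
  -- the orbit
  have horbit : ∀ n : ℕ, ∃ w : ℕ, f w = 1 ∧ Nat.Coprime a w ∧ (∃ k, w = q ^ i * k + 1) ∧
      (w : ℝ) = (1 - ((q : ℝ) ^ d - 1) / ((q : ℝ) ^ d * a - 1)) * ((q : ℝ) ^ d * a) ^ n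
        + ((q : ℝ) ^ d - 1) / ((q : ℝ) ^ d * a - 1) := by
    intro n
    induction n with
    | zero => exact ⟨1, hf1, by simp, ⟨0, by simp⟩, by simp⟩
    | succ n ih =>
      obtain ⟨w, hfw, hcw, ⟨k, hk⟩, hw⟩ := ih
      obtain ⟨K, hK⟩ : ∃ K, a * w = q ^ i * K + 1 :=
        ⟨q ^ i * α * k + α + k, by rw [hα, hk]; ring⟩
      have hnew : q ^ (i + d) * K + 1 + (q ^ d - 1) = q ^ d * (a * w) := by
        have : q ^ (i + d) * K + 1 + (q ^ d - 1) = q ^ (i + d) * K + q ^ d := by omega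
        rw [this, hK]
        ring
      refine ⟨q ^ (i + d) * K + 1, ?_, ?_, ⟨q ^ d * K, by ring⟩, ?_⟩
      · rw [hrep, ← hK, hmul _ _ hcw, hfa, hfw, one_mul]
      · apply Nat.coprime_of_dvd
        intro t ht hta htw
        have h1 : t ∣ q ^ d * (a * w) := (hta.mul_right w).mul_left _
        rw [← hnew] at h1
        have h2 : t ∣ q ^ d - 1 := (Nat.dvd_add_right htw).1 h1
        exact Nat.not_coprime_of_dvd_of_dvd ht.one_lt hta h2 haD
      · have h1 : ((q ^ (i + d) * K + 1 : ℕ) : ℝ) = (q : ℝ) ^ d * (a * w) - ((q : ℝ) ^ d - 1) := by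
          have h2 : ((q ^ (i + d) * K + 1 + (q ^ d - 1) : ℕ) : ℝ)
            = ((q ^ d * (a * w) : ℕ) : ℝ) := by rw [hnew]
          rw [Nat.cast_add, Nat.cast_sub (by omega)] at h2
          push_cast at h2 ⊢
          linarith
        have hpos : (0 : ℝ) < (q : ℝ) ^ d * a - 1 := by
          have h3 : 1 < q ^ d * a := by nlinarith
          have h4 : (1 : ℝ) < (q : ℝ) ^ d * a := by exact_mod_cast h3
          linarith
        rw [h1, hw, pow_succ]
        field_simp
        ring
  set B : ℝ := (q : ℝ) ^ d * a with hBdef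
  have hqdR : (2 : ℝ) ≤ (q : ℝ) ^ d := by exact_mod_cast hqd
  have haR : (2 : ℝ) ≤ (a : ℝ) := by exact_mod_cast ha1
  have hqR : (2 : ℝ) ≤ (q : ℝ) := by exact_mod_cast hq
  have hB : 1 < B := by nlinarith
  set x : ℝ := ((q : ℝ) ^ d - 1) / (B - 1) with hx
  have hx0 : 0 ≤ x := div_nonneg (by linarith) (by linarith)
  have hx1 : x < 1 := by
    rw [hx, div_lt_one (by linarith)]
    nlinarith
  have hNR : (1 : ℝ) ≤ N := by exact_mod_cast hN0
  have hev : ∀ᶠ n : ℕ in atTop, (q : ℝ) * (N + 1) < (1 - x) * B ^ n :=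
    ((tendsto_pow_atTop_atTop_of_one_lt hB).const_mul_atTop
      (by linarith : 0 < 1 - x)).eventually_gt_atTop _
  obtain ⟨C, hC⟩ := eventually_atTop.1 hev
  obtain ⟨n, hn, m, hm1, hm2⟩ := density_aux q B (1 - x) N (N + 1 / 2) (by linarith) hB
    (by linarith) (by linarith) (by linarith) (irr_aux q d a hq ha1 haq) C
  have hm : 1 ≤ m := by
    by_contra hlt
    have h1 : (q : ℝ) ^ m ≤ (q : ℝ) ^ (0 : ℤ) := zpow_le_zpow_right₀ (by linarith) (by omega)
    rw [zpow_zero] at h1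
    have h2 := hC n hn
    nlinarith
  obtain ⟨m', rfl⟩ := Int.eq_ofNat_of_zero_le (by omega : 0 ≤ m)
  rw [zpow_natCast] at hm1 hm2
  have hm' : 1 ≤ m' := by exact_mod_cast hm
  obtain ⟨w, hfw, -, -, hw⟩ := horbit n
  have hqm : (2 : ℝ) ≤ (q : ℝ) ^ m' := by
    calc (2 : ℝ) ≤ (q : ℝ) ^ 1 := by simpa using hqR
      _ ≤ (q : ℝ) ^ m' := pow_le_pow_right₀ (by linarith) hm'
  have hlo : q ^ m' * N ≤ w := by
    have : (q : ℝ) ^ m' * N ≤ w := by rw [hw]; linarith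
    exact_mod_cast this
  have hhi : w < q ^ m' * N + q ^ m' := by
    have : (w : ℝ) < (q : ℝ) ^ m' * N + (q : ℝ) ^ m' := by rw [hw]; nlinarith
    exact_mod_cast this
  have h0 := hN m' (w - q ^ m' * N) hm' (by omega)
  rw [Nat.add_sub_cancel' hlo, hfw] at h0
  exact one_ne_zero h0
end

section
/- Let q ≥ 2 and let f : ℕ → ℂ be a multiplicative q-automatic function. If the set of primes p with f(p) = 0 is infinite, then the set of primes p such that f(p^e) ≠ 0 for some integer e ≥ 1 is finite. -/
lemma coprime_of_lt_prime_aux {p m : ℕ} (hp : p.Prime) (hm : 0 < m) (h : m < p) :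
    Nat.Coprime p m :=
  hp.coprime_iff_not_dvd.2 fun hd => absurd (Nat.le_of_dvd hm hd) (by omega)

/-- If `f` vanishes at infinitely many primes, finitely many kernel sequences have a common zero,
along a whole residue class. -/
lemma exists_common_zero (q : ℕ) (hq : 2 ≤ q) (f : ℕ → ℂ)
    (hmul : ∀ m n : ℕ, Nat.Coprime m n → f (m * n) = f m * f n)
    (hinf : {p : ℕ | p.Prime ∧ f p = 0}.Infinite) (S : Finset (ℕ × ℕ)) :
    ∃ N M : ℕ, 1 ≤ N ∧ 1 ≤ M ∧ ∀ s ∈ S, ∀ t : ℕ, f (q ^ s.1 * (N + M * t) + s.2) = 0 := by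
  classical
  induction S using Finset.induction_on with
  | empty => exact ⟨1, 1, le_rfl, le_rfl, by simp⟩
  | insert a S ha ih =>
    obtain ⟨N, M, hN, hM, h⟩ := ih
    obtain ⟨p, ⟨hp, hfp⟩, hlt⟩ := hinf.exists_gt (M * q)
    have hpM : Nat.Coprime p M :=
      coprime_of_lt_prime_aux hp (by omega) (by nlinarith)
    have hpq : Nat.Coprime p q :=
      coprime_of_lt_prime_aux hp (by omega) (by nlinarith)
    have hcop : Nat.Coprime (q ^ a.1 * M) (p ^ 2) :=
      (Nat.Coprime.mul_right (hpq.pow_right _) hpM).symm.pow_right 2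
    obtain ⟨t0, ht0⟩ : ∃ t0 : ℕ, q ^ a.1 * M * t0 + (q ^ a.1 * N + a.2) ≡ p [MOD p ^ 2] := by
      have : NeZero (p ^ 2) := ⟨(pow_pos hp.pos 2).ne'⟩
      refine ⟨(((p : ZMod (p ^ 2)) - ((q ^ a.1 * N + a.2 : ℕ) : ZMod (p ^ 2))) *
        ((q ^ a.1 * M : ℕ) : ZMod (p ^ 2))⁻¹).val, ?_⟩
      rw [← ZMod.natCast_eq_natCast_iff]
      have h1 := ZMod.coe_mul_inv_eq_one _ hcop
      rw [Nat.cast_add, Nat.cast_mul (q ^ a.1 * M), ZMod.natCast_zmod_val]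
      linear_combination ((p : ZMod (p ^ 2)) - ((q ^ a.1 * N + a.2 : ℕ) : ZMod (p ^ 2))) * h1
    refine ⟨N + M * t0, M * p ^ 2, by omega, Nat.mul_pos hM (pow_pos hp.pos 2), ?_⟩
    intro s hs t
    rcases Finset.mem_insert.1 hs with rfl | hs
    · set n := q ^ s.1 * (N + M * t0 + M * p ^ 2 * t) + s.2 with hn
      have hmod : n ≡ p [MOD p ^ 2] := by
        have : n = (q ^ s.1 * M * t0 + (q ^ s.1 * N + s.2)) + p ^ 2 * (q ^ s.1 * M * t) := by
          rw [hn]; ring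
        rw [this]
        have h2 : p ^ 2 * (q ^ s.1 * M * t) ≡ 0 [MOD p ^ 2] :=
          (Nat.modEq_zero_iff_dvd).2 (dvd_mul_right _ _)
        simpa using ht0.add h2
      have hpn : p ∣ n := by
        have h3 : n ≡ p [MOD p] := hmod.of_dvd (dvd_pow_self p (by norm_num))
        exact (h3.dvd_iff dvd_rfl).2 dvd_rfl
      obtain ⟨m, hm⟩ := hpn
      have hm1 : m ≡ 1 [MOD p] := by
        rw [hm, pow_two] at hmod
        apply Nat.ModEq.mul_left_cancel' (c := p) hp.ne_zero
        simpa using hmod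
      have hcm : Nat.Coprime p m := by
        rw [hp.coprime_iff_not_dvd]
        intro hd
        have := (hm1.dvd_iff dvd_rfl).1 hd
        exact hp.one_lt.ne' (Nat.dvd_one.1 this)
      rw [hm, hmul _ _ hcm, hfp, zero_mul]
    · have := h s hs (t0 + p ^ 2 * t)
      rw [← this]; congr 1; ring

/-- There is a prefix `W` killing `f`. -/
lemma exists_zero_prefix (q : ℕ) (hq : 2 ≤ q) (f : ℕ → ℂ)
    (hmul : ∀ m n : ℕ, Nat.Coprime m n → f (m * n) = f m * f n)
    (hauto : IsQAutomatic q f)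
    (hinf : {p : ℕ | p.Prime ∧ f p = 0}.Infinite) :
    ∃ W : ℕ, 1 ≤ W ∧ ∀ i r : ℕ, 1 ≤ i → r < q ^ i → f (q ^ i * W + r) = 0 := by
  classical
  have hex : ∀ g : ℕ → ℂ, ∃ s : ℕ × ℕ, g ∈ qKernel q f →
      g = fun n => f (q ^ s.1 * n + s.2) := by
    intro g
    by_cases hg : g ∈ qKernel q f
    · obtain ⟨i, r, -, -, h⟩ := hg
      exact ⟨(i, r), fun _ => h⟩
    · exact ⟨(0, 0), fun h => absurd h hg⟩
  choose s hs using hex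
  have hfin : (qKernel q f).Finite := hauto
  obtain ⟨N, M, hN, -, h⟩ :=
    exists_common_zero q hq f hmul hinf (hfin.toFinset.image s)
  refine ⟨N, hN, fun i r hi hr => ?_⟩
  have hg : (fun n => f (q ^ i * n + r)) ∈ qKernel q f := ⟨i, r, hi, by omega, rfl⟩
  have h1 := h (s _) (Finset.mem_image_of_mem s (hfin.mem_toFinset.2 hg)) 0
  have h2 := congrFun (hs _ hg) N
  rw [h2]
  simpa using h1

/-- Pumping lemma. -/
lemma pump (q : ℕ) (hq : 2 ≤ q) (f : ℕ → ℂ) (hauto : IsQAutomatic q f) :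
    ∃ B : ℕ, ∀ a : ℕ, B ≤ a → Nat.Coprime a q → f a ≠ 0 →
      ∃ (n : ℕ → ℕ) (e : ℕ) (b : ℤ), 1 ≤ e ∧ b ≠ 0 ∧
        (∀ k, (n (k + 1) : ℤ) = (q : ℤ) ^ e * n k + b) ∧ (∀ k, k ≤ n k) ∧
        (∀ k, Nat.Coprime (n k) q) ∧ (∀ k, f (n k) ≠ 0) := by
  classical
  have hfin : (qKernel q f).Finite := hauto
  set K := hfin.toFinset.card with hK
  refine ⟨q ^ (K + 2), fun a ha hcop hfa => ?_⟩
  have hq0 : 0 < q := by omega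
  obtain ⟨i, j, hi, hij, hjK, heq⟩ : ∃ i j : ℕ, 1 ≤ i ∧ i < j ∧ j ≤ K + 1 ∧
      (fun n => f (q ^ i * n + a % q ^ i)) = (fun n => f (q ^ j * n + a % q ^ j)) := by
    have := Finset.exists_ne_map_eq_of_card_lt_of_maps_to (s := Finset.Icc 1 (K + 1))
      (t := hfin.toFinset) (by simp [← hK])
      (f := fun i => fun n => f (q ^ i * n + a % q ^ i)) (by
        intro i hi
        simp only [Finset.coe_Icc, Set.mem_Icc] at hi
        have h0 := Nat.mod_lt a (pow_pos hq0 i)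
        simp only [Set.Finite.coe_toFinset]
        exact ⟨i, a % q ^ i, hi.1, by omega, rfl⟩)
    obtain ⟨x, hx, y, hy, hxy, h⟩ := this
    rw [Finset.mem_Icc] at hx hy
    rcases lt_or_gt_of_ne hxy with hl | hl
    · exact ⟨x, y, hx.1, hl, hy.2, h⟩
    · exact ⟨y, x, hy.1, hl, hx.2, h.symm⟩
  obtain ⟨e, rfl⟩ : ∃ e, j = i + e := ⟨j - i, by omega⟩
  have he : 1 ≤ e := by omega
  set ri := a % q ^ i with hri
  set rj := a % q ^ (i + e) with hrj
  set u := a / q ^ (i + e) with hu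
  set v := rj / q ^ i with hv
  have hrji : rj % q ^ i = ri := by
    rw [hrj, hri]; exact Nat.mod_mod_of_dvd _ (pow_dvd_pow _ (by omega))
  have hrjv : rj = q ^ i * v + ri := by rw [← hrji, hv]; exact (Nat.div_add_mod _ _).symm
  have hau : a = q ^ (i + e) * u + rj := (Nat.div_add_mod _ _).symm
  have hai : a = q ^ i * (a / q ^ i) + ri := (Nat.div_add_mod _ _).symm
  have hu1 : 1 ≤ u := by
    rw [hu, Nat.one_le_div_iff (pow_pos hq0 _)]
    exact (Nat.pow_le_pow_right hq0 (by omega)).trans ha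
  have hric : Nat.Coprime ri q := by
    obtain ⟨i', rfl⟩ : ∃ i', i = i' + 1 := ⟨i - 1, by omega⟩
    rw [hai, pow_succ, mul_comm (q ^ i') q, mul_assoc] at hcop
    simpa using hcop
  have hcopgen : ∀ x, Nat.Coprime (q ^ i * x + ri) q := by
    intro x
    obtain ⟨i', rfl⟩ : ∃ i', i = i' + 1 := ⟨i - 1, by omega⟩
    rw [pow_succ, mul_comm (q ^ i') q, mul_assoc]
    simpa using hric
  let U : ℕ → ℕ := fun k => Nat.rec u (fun _ x => q ^ e * x + v) k
  have hU0 : U 0 = u := rfl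
  have hU : ∀ k, U (k + 1) = q ^ e * U k + v := fun k => rfl
  have hqe : 2 ≤ q ^ e := hq.trans (Nat.le_self_pow (by omega) q)
  have hUk : ∀ k, k + 1 ≤ U k := by
    intro k
    induction k with
    | zero => rw [hU0]; omega
    | succ k ih => rw [hU]; nlinarith
  refine ⟨fun k => q ^ i * U k + ri, e, (rj : ℤ) - q ^ e * ri, he, ?_, ?_, ?_, ?_, ?_⟩
  · intro h0
    have h1 : rj = q ^ e * ri := by zify; linarith
    have h2 : Nat.Coprime rj q := by rw [hrjv]; exact hcopgen v
    rw [h1] at h2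
    have h3 : q ∣ q ^ e * ri := (dvd_pow_self q (by omega)).mul_right _
    have := Nat.Coprime.eq_one_of_dvd h2.symm h3
    omega
  · intro k
    simp only [hU]
    rw [hrjv]; push_cast; ring
  · intro k
    have := hUk k
    have h1 : 1 ≤ q ^ i := pow_pos hq0 i
    show k ≤ q ^ i * U k + ri
    nlinarith
  · intro k; exact hcopgen _
  · intro k
    show f (q ^ i * U k + ri) ≠ 0
    have hstep : ∀ x, f (q ^ i * (q ^ e * x + v) + ri) = f (q ^ i * x + ri) := by
      intro x
      have h1 := congrFun heq x
      rw [h1, hrjv]; congr 1; ring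
    induction k with
    | zero =>
      have h1 := congrFun heq u
      rw [hU0, h1, ← hau]; exact hfa
    | succ k ih => rw [hU, hstep]; exact ih

/-- Dividing one member of the pumped family by another. -/
lemma step (q : ℕ) (hq : 2 ≤ q) (n : ℕ → ℕ) (e : ℕ) (b : ℤ) (he : 1 ≤ e)
    (hrec : ∀ k, (n (k + 1) : ℤ) = (q : ℤ) ^ e * n k + b)
    (hcop : ∀ k, Nat.Coprime (n k) q) (k0 P : ℕ) (hP : Nat.Coprime P q) :
    ∃ c t : ℕ, ∃ y : ℝ, n k0 * c = n (k0 + t) ∧ Nat.Coprime c P ∧ Nat.Coprime c (n k0) ∧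
      1 / (q : ℝ) ^ e ≤ y ∧ y ≤ 1 ∧
      (c : ℝ) = (q : ℝ) ^ (e * t) * (1 + b / n k0 * y) := by
  have hqe : 2 ≤ q ^ e := hq.trans (Nat.le_self_pow (by omega) q)
  set Q := q ^ e with hQ
  set N := n k0 with hN
  have hN0 : 0 < N := by
    rcases Nat.eq_zero_or_pos N with h | h
    · have := hcop k0; rw [← hN, h] at this; simp at this; omega
    · exact h
  have hP0 : 0 < P := by
    rcases Nat.eq_zero_or_pos P with h | h
    · rw [h] at hP; simp at hP; omega
    · exact h
  obtain ⟨D, hD⟩ : ∃ D, Q = D + 1 := ⟨Q - 1, by omega⟩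
  have hD0 : 0 < D := by omega
  set M := N * (P * N) with hM
  have hM0 : 0 < M := by positivity
  have hcQ : Nat.Coprime Q (D * M) := by
    refine Nat.Coprime.mul_right (by rw [hD]; simp) ?_
    have h1 : Nat.Coprime Q N := (hcop k0).symm.pow_left e
    have h2 : Nat.Coprime Q P := hP.symm.pow_left e
    exact h1.mul_right (h2.mul_right h1)
  set t := Nat.totient (D * M) with ht
  have ht0 : 0 < t := Nat.totient_pos.2 (by positivity)
  have hmod : Q ^ t ≡ 1 [MOD D * M] := Nat.ModEq.pow_totient hcQ
  set G := ∑ i ∈ Finset.range t, Q ^ i with hG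
  have hGD : D * G + 1 = Q ^ t := by
    have h3 : ((∑ i ∈ Finset.range t, (Q : ℤ) ^ i) * ((Q : ℤ) - 1)) = (Q : ℤ) ^ t - 1 :=
      geom_sum_mul _ _
    zify
    rw [hG]; push_cast
    have h4 : (Q : ℤ) = D + 1 := by exact_mod_cast hD
    have h5 : (D : ℤ) = Q - 1 := by linarith
    rw [h5]; linarith
  have hMG : M ∣ G := by
    have h1 : D * M ∣ D * G := by
      have := (Nat.modEq_iff_dvd' (Nat.one_le_pow _ _ (by omega))).1 hmod.symm
      rwa [← hGD, Nat.add_sub_cancel] at this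
    exact Nat.dvd_of_mul_dvd_mul_left hD0 h1
  have hform : ∀ s, (n (k0 + s) : ℤ) = (Q : ℤ) ^ s * N + b * ∑ i ∈ Finset.range s, (Q : ℤ) ^ i := by
    intro s
    induction s with
    | zero => simp [hN]
    | succ s ih =>
      rw [← add_assoc, hrec, ih, geom_sum_succ, hQ]; push_cast; ring
  have hnt : (n (k0 + t) : ℤ) = (Q : ℤ) ^ t * N + b * G := by
    rw [hform, hG]; push_cast; rfl
  obtain ⟨G', hG'⟩ := hMG
  have hQt : (Q : ℤ) ^ t = D * G + 1 := by exact_mod_cast hGD.symm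
  have hdvd : N ∣ n (k0 + t) := by
    zify
    rw [hnt]
    refine dvd_add (dvd_mul_left _ _) (Dvd.dvd.mul_left ?_ _)
    rw [hG', hM]; push_cast
    exact ⟨P * N * G', by ring⟩
  obtain ⟨c, hc⟩ := hdvd
  have hcZ : (c : ℤ) = 1 + P * N * ((D * N + b) * G') := by
    have h1 : (N : ℤ) ≠ 0 := by exact_mod_cast hN0.ne'
    apply mul_left_cancel₀ h1
    have h2 : (N : ℤ) * c = n (k0 + t) := by exact_mod_cast hc.symm
    rw [h2, hnt, hQt, hG', hM]; push_cast; ring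
  have hcc : ∀ d : ℕ, (d : ℤ) ∣ (P : ℤ) * N → Nat.Coprime c d := by
    intro d hd
    rw [← Nat.isCoprime_iff_coprime]
    obtain ⟨z, hz⟩ := hd
    rw [hcZ, hz]
    exact ⟨1, -(z * ((D * N + b) * G')), by ring⟩
  have hNR : (0 : ℝ) < N := by exact_mod_cast hN0
  have hQR : (2 : ℝ) ≤ Q := by exact_mod_cast hqe
  have hQtR : (0 : ℝ) < (Q : ℝ) ^ t := by positivity
  have hQQ : (q : ℝ) ^ e = Q := by rw [hQ]; push_cast; rfl
  refine ⟨c, t, (G : ℝ) / (Q : ℝ) ^ t, hc.symm, hcc P ⟨N, rfl⟩, hcc N ⟨P, by ring⟩, ?_, ?_, ?_⟩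
  · rw [hQQ, div_le_div_iff₀ (by linarith) hQtR, one_mul]
    have h1 : Q ^ (t - 1) ≤ G :=
      Finset.single_le_sum (f := fun i => Q ^ i) (fun _ _ => Nat.zero_le _)
        (Finset.mem_range.2 (by omega))
    have h2 : Q ^ t ≤ G * Q := by
      calc Q ^ t = Q ^ (t - 1) * Q := by rw [← pow_succ]; congr 1; omega
        _ ≤ G * Q := Nat.mul_le_mul_right _ h1
    exact_mod_cast h2
  · rw [div_le_one hQtR]
    have : G ≤ Q ^ t := by nlinarith
    exact_mod_cast this
  · rw [pow_mul, hQQ]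
    have h2 : (N : ℝ) * c = (Q : ℝ) ^ t * N + b * G := by
      have : (N : ℤ) * c = (Q : ℤ) ^ t * N + b * G := by
        rw [← hnt, hc]; push_cast; rfl
      exact_mod_cast this
    field_simp
    linarith

/-- No family as in the pumping lemma can exist. -/
lemma no_family (q : ℕ) (hq : 2 ≤ q) (f : ℕ → ℂ)
    (hmul : ∀ m n : ℕ, Nat.Coprime m n → f (m * n) = f m * f n)
    (W : ℕ) (hW : 1 ≤ W) (hz : ∀ i r : ℕ, 1 ≤ i → r < q ^ i → f (q ^ i * W + r) = 0)
    (n : ℕ → ℕ) (e : ℕ) (b : ℤ) (he : 1 ≤ e) (hb : b ≠ 0)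
    (hrec : ∀ k, (n (k + 1) : ℤ) = (q : ℤ) ^ e * n k + b)
    (hn : ∀ k, k ≤ n k)
    (hcop : ∀ k, Nat.Coprime (n k) q) (hf : ∀ k, f (n k) ≠ 0) : False := by
  have hq0 : (0 : ℝ) < q := by exact_mod_cast (by omega : 0 < q)
  have hq1 : (1 : ℝ) < q := by exact_mod_cast (by omega : 1 < q)
  have hWR : (1 : ℝ) ≤ W := by exact_mod_cast hW
  let R : Set ℝ := {x | ∃ P : ℕ, ∃ m : ℤ, Nat.Coprime P q ∧ f P ≠ 0 ∧ x = P * (q : ℝ) ^ m}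
  have hgap : ∀ x ∈ R, W < x → x < W + 1 → False := by
    rintro x ⟨P, m, hPq, hfP, rfl⟩ h1 h2
    rcases le_or_gt 0 m with hm | hm
    · obtain ⟨l, rfl⟩ := Int.eq_ofNat_of_zero_le hm
      have h1' : W < P * q ^ l := by exact_mod_cast h1
      have h2' : P * q ^ l < W + 1 := by exact_mod_cast h2
      omega
    · obtain ⟨l, rfl⟩ : ∃ l : ℕ, m = -(l : ℤ) := ⟨m.natAbs, by omega⟩
      have hl : 1 ≤ l := by omega
      have hql : (0 : ℝ) < (q : ℝ) ^ l := by positivity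
      rw [zpow_neg, zpow_natCast, ← div_eq_mul_inv] at h1 h2
      rw [lt_div_iff₀ hql] at h1
      rw [div_lt_iff₀ hql] at h2
      have h1' : W * q ^ l < P := by exact_mod_cast h1
      have h2' : P < (W + 1) * q ^ l := by exact_mod_cast h2
      apply hfP
      have h3 := hz l (P - q ^ l * W) hl (by
        rw [mul_comm] at h1'
        have : (W + 1) * q ^ l = q ^ l * W + q ^ l := by ring
        omega)
      rwa [Nat.add_sub_cancel' (by rw [mul_comm]; exact h1'.le)] at h3
  have hpos : ∀ x ∈ R, 0 < x := by
    rintro x ⟨P, m, hPq, hfP, rfl⟩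
    have : 0 < P := by
      rcases Nat.eq_zero_or_pos P with h | h
      · rw [h] at hPq; simp at hPq; omega
      · exact h
    have : (0 : ℝ) < P := by exact_mod_cast this
    positivity
  obtain ⟨k0, hk0⟩ : ∃ k0 : ℕ, k0 = b.natAbs * (W + 1) + 1 := ⟨_, rfl⟩
  have hNk : ((b.natAbs : ℝ)) * (W + 1) < n k0 := by
    have := hn k0
    have : b.natAbs * (W + 1) < n k0 := by omega
    exact_mod_cast this
  have hNpos : (0 : ℝ) < n k0 := lt_of_le_of_lt (by positivity) hNk
  set β : ℝ := b / n k0 with hβ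
  have hβabs : |β| * (W + 1) < 1 := by
    rw [hβ, abs_div, abs_of_pos hNpos, div_mul_eq_mul_div, div_lt_one hNpos]
    rwa [Nat.cast_natAbs, Int.cast_abs] at hNk
  have hβ0 : β ≠ 0 := by
    rw [hβ]
    exact div_ne_zero (by exact_mod_cast hb) hNpos.ne'
  set y0 : ℝ := 1 / (q : ℝ) ^ e with hy0
  have hy0pos : 0 < y0 := by positivity
  have hstep : ∀ x ∈ R, ∃ y : ℝ, y0 ≤ y ∧ y ≤ 1 ∧ x * (1 + β * y) ∈ R := by
    rintro x ⟨P, m, hPq, hfP, rfl⟩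
    obtain ⟨c, t, y, hc, hcP, hcN, hy1, hy2, hcy⟩ := step q hq n e b he hrec hcop k0 P hPq
    refine ⟨y, hy1, hy2, c * P, m - (e * t : ℕ), ?_, ?_, ?_⟩
    · have h1 := hcop (k0 + t)
      rw [← hc] at h1
      exact (Nat.Coprime.coprime_mul_left h1).mul_left hPq
    · rw [hmul _ _ hcP]
      refine mul_ne_zero ?_ hfP
      have h1 := hf (k0 + t)
      rw [← hc, hmul _ _ hcN.symm] at h1
      exact right_ne_zero_of_mul h1
    · rw [zpow_sub₀ hq0.ne', zpow_natCast]
      push_cast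
      rw [hcy, ← hβ]
      have : (q : ℝ) ^ (e * t) ≠ 0 := by positivity
      generalize β = β'
      field_simp
  have hscale : ∀ m : ℤ, (n 0 : ℝ) * (q : ℝ) ^ m ∈ R := fun m => ⟨n 0, m, hcop 0, hf 0, rfl⟩
  have hn0 : (0 : ℝ) < n 0 := by simpa using hpos _ (hscale 0)
  rcases lt_or_gt_of_ne hβ0 with hneg | hposβ
  ·
    rw [abs_of_neg hneg] at hβabs
    obtain ⟨l, hl⟩ := pow_unbounded_of_one_lt ((W : ℝ) + 1) hq1
    have hn1 : (1 : ℝ) ≤ n 0 := by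
      have : 0 < n 0 := by exact_mod_cast hn0
      exact_mod_cast this
    have hx0 : (W : ℝ) + 1 ≤ n 0 * (q : ℝ) ^ (l : ℤ) := by
      rw [zpow_natCast]; nlinarith
    set x0 : ℝ := n 0 * (q : ℝ) ^ (l : ℤ) with hx0def
    have hb1 : 0 ≤ 1 + β * y0 := by
      have : y0 ≤ 1 := by
        rw [hy0]; exact div_le_one_of_le₀ (one_le_pow₀ hq1.le) (by positivity)
      nlinarith
    have hind : ∀ r : ℕ, ∃ x ∈ R, (W : ℝ) + 1 ≤ x ∧ x ≤ x0 * (1 + β * y0) ^ r := by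
      intro r
      induction r with
      | zero => exact ⟨x0, hscale _, hx0, by simp⟩
      | succ r ih =>
        obtain ⟨x, hxR, hx1, hx2⟩ := ih
        obtain ⟨y, hy1, hy2, hR⟩ := hstep x hxR
        refine ⟨_, hR, ?_, ?_⟩
        · by_contra hlt
          push Not at hlt
          refine hgap _ hR ?_ hlt
          have h1 : 1 + β ≤ 1 + β * y := by nlinarith
          have h2 : 0 < 1 + β := by nlinarith
          calc (W : ℝ) < (W + 1) * (1 + β) := by nlinarith
            _ ≤ x * (1 + β) := mul_le_mul_of_nonneg_right hx1 h2.le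
            _ ≤ x * (1 + β * y) := mul_le_mul_of_nonneg_left h1 (hpos _ hxR).le
        · have h1 : 1 + β * y ≤ 1 + β * y0 := by nlinarith
          calc x * (1 + β * y) ≤ x * (1 + β * y0) :=
                mul_le_mul_of_nonneg_left h1 (hpos _ hxR).le
            _ ≤ (x0 * (1 + β * y0) ^ r) * (1 + β * y0) := mul_le_mul_of_nonneg_right hx2 hb1
            _ = x0 * (1 + β * y0) ^ (r + 1) := by ring
    have hlt1 : 1 + β * y0 < 1 := by nlinarith
    have hx0p : 0 < x0 := by linarith
    obtain ⟨r, hr⟩ := exists_pow_lt_of_lt_one (show 0 < 1 / x0 by positivity) hlt1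
    obtain ⟨x, hxR, hx1, hx2⟩ := hind r
    rw [lt_div_iff₀ hx0p] at hr
    linarith
  ·
    rw [abs_of_pos hposβ] at hβabs
    obtain ⟨l, hl⟩ := pow_unbounded_of_one_lt (n 0 : ℝ) hq1
    have hx0 : n 0 * (q : ℝ) ^ (-(l : ℤ)) ≤ W := by
      rw [zpow_neg, zpow_natCast, ← div_eq_mul_inv]
      exact (div_le_one_of_le₀ hl.le (by positivity)).trans hWR
    set x0 : ℝ := n 0 * (q : ℝ) ^ (-(l : ℤ)) with hx0def
    have hx0p : 0 < x0 := by positivity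
    have hind : ∀ r : ℕ, ∃ x ∈ R, x ≤ W ∧ x0 * (1 + β * y0) ^ r ≤ x := by
      intro r
      induction r with
      | zero => exact ⟨x0, hscale _, hx0, by simp⟩
      | succ r ih =>
        obtain ⟨x, hxR, hx1, hx2⟩ := ih
        obtain ⟨y, hy1, hy2, hR⟩ := hstep x hxR
        refine ⟨_, hR, ?_, ?_⟩
        · by_contra hlt
          push Not at hlt
          refine hgap _ hR hlt ?_
          have h1 : 1 + β * y ≤ 1 + β := by nlinarith
          calc x * (1 + β * y) ≤ x * (1 + β) := mul_le_mul_of_nonneg_left h1 (hpos _ hxR).le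
            _ ≤ W * (1 + β) := mul_le_mul_of_nonneg_right hx1 (by linarith)
            _ < W + 1 := by nlinarith
        · have h1 : 1 + β * y0 ≤ 1 + β * y := by nlinarith
          have h0 : 0 ≤ 1 + β * y0 := by positivity
          calc x0 * (1 + β * y0) ^ (r + 1) = (x0 * (1 + β * y0) ^ r) * (1 + β * y0) := by ring
            _ ≤ x * (1 + β * y0) := mul_le_mul_of_nonneg_right hx2 h0
            _ ≤ x * (1 + β * y) := mul_le_mul_of_nonneg_left h1 (hpos _ hxR).le
    have hgt1 : 1 < 1 + β * y0 := by nlinarith [mul_pos hposβ hy0pos]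
    obtain ⟨r, hr⟩ := pow_unbounded_of_one_lt ((W : ℝ) / x0) hgt1
    obtain ⟨x, hxR, hx1, hx2⟩ := hind r
    rw [div_lt_iff₀ hx0p] at hr
    linarith

theorem stmt_14 (q : ℕ) (hq : 2 ≤ q) (f : ℕ → ℂ)
    (hmul : ∀ m n : ℕ, Nat.Coprime m n → f (m * n) = f m * f n)
    (hauto : IsQAutomatic q f)
    (hinf : {p : ℕ | p.Prime ∧ f p = 0}.Infinite) :
    {p : ℕ | p.Prime ∧ ∃ e : ℕ, 1 ≤ e ∧ f (p ^ e) ≠ 0}.Finite := by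
  obtain ⟨W, hW, hz⟩ := exists_zero_prefix q hq f hmul hauto hinf
  obtain ⟨B, hB⟩ := pump q hq f hauto
  refine (Set.finite_le_nat (B + q)).subset ?_
  rintro p ⟨hp, e, he, hfe⟩
  by_contra hlt
  replace hlt : B + q < p := not_le.1 hlt
  have hpq : Nat.Coprime p q := coprime_of_lt_prime_aux hp (by omega) (by omega)
  have hle : p ≤ p ^ e := Nat.le_self_pow (by omega) p
  obtain ⟨n, e', b, he', hb, hrec, hn, hcop, hf⟩ :=
    hB (p ^ e) (by omega) (hpq.pow_left e) hfe
  exact no_family q hq f hmul W hW hz n e' b he' hb hrec hn hcop hf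
end
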